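/- Let P = (p^(1),…,p^(d)) and Q = (q^(1),…,q^(d)) be d-tuples of probability vectors with ∩_{k∈[d]} supp p^(k) ≠ ∅ and supp p^(k) ⊆ supp p^(d) for all k ∈ [d−1], and likewise for Q. Suppose: (1) Φ_{α,C}(P) < Φ_{α,C}(Q) for every α ∈ A_+ and supp α ⊆ C ⊆ [d] with (α,C) not degenerate on V^d_{d.c.}; (2) Φ_{α,c}(P) > Φ_{α,c}(Q) for every c ∈ [d−1] and every real α > 1; (3) D₁(p^(k)‖p^(d)) > D₁(q^(k)‖q^(d)) and D_∞(p^(k)‖p^(d)) > D_∞(q^(k)‖q^(d)) for every k ∈ [d−1]. Then: (a) there exist a stochastic matrix T and probability vectors r^(1),…,r^(d) with ∩_{k∈[d]} supp r^(k) ≠ ∅ and supp r^(k) ⊆ supp r^(d) for k ∈ [d−1], such that T(r^(k) ⊗ p^(k)) = r^(k) ⊗ q^(k) for all k ∈ [d]; moreover for all sufficiently large n one may take r^(k) = (1/(n+1)) ⊕_{ℓ=0}^{n} (q^(k))^{⊗ℓ} ⊗ (p^(k))^{⊗(n−ℓ)}; (b) for all sufficiently large n there exists a stochastic matrix T_n with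 T_n (p^(k))^{⊗n} = (q^(k))^{⊗n} for all k ∈ [d]. Conversely, if (a) holds for some such T and r^(1),…,r^(d), or (b) holds for some n ≥ 1, then the inequalities in (1), (2), (3) hold non-strictly. -/

import Mathlib

open Classical

noncomputable section

/-- `p` is a probability vector. -/
def IsProb {I : Type} [Fintype I] (p : I → ℝ) : Prop :=
  (∀ x, 0 ≤ p x) ∧ ∑ x, p x = 1

/-- `T` is a (column-)stochastic matrix (`T y x` is the entry in row `y`, column `x`). -/
def IsStoch {I J : Type} [Fintype I] [Fintype J] (T : J → I → ℝ) : Prop :=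
  (∀ y x, 0 ≤ T y x) ∧ ∀ x, ∑ y, T y x = 1

/-- Kronecker product of two vectors. -/
def kron {I J : Type} (p : I → ℝ) (q : J → ℝ) : I × J → ℝ := fun x => p x.1 * q x.2

/-- `n`-fold Kronecker power `p^{⊗n}`. -/
def kpow {I : Type} (p : I → ℝ) (n : ℕ) : (Fin n → I) → ℝ := fun f => ∏ j, p (f j)

/-- Index type of the catalyst `⊕_{ℓ=0}^{n} (q)^{⊗ℓ} ⊗ (p)^{⊗(n-ℓ)}`
(`I` indexes `p`, `J` indexes `q`). -/
abbrev CatIdx (I J : Type) (n : ℕ) : Type :=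
  (ℓ : Fin (n + 1)) × ((Fin (ℓ : ℕ) → J) × (Fin (n - (ℓ : ℕ)) → I))

/-- The catalyst `r = (1/(n+1)) ⊕_{ℓ=0}^{n} q^{⊗ℓ} ⊗ p^{⊗(n-ℓ)}`. -/
def catVec {I J : Type} (n : ℕ) (p : I → ℝ) (q : J → ℝ) : CatIdx I J n → ℝ :=
  fun x => (1 / (n + 1 : ℝ)) * ((∏ j, q (x.2.1 j)) * ∏ j, p (x.2.2 j))

/-- The multivariate monotone `Φ_{α,C}` (convention `0^0 = 1` of `rpow`). -/
def phiAC {I : Type} [Fintype I] (d : ℕ) (α : Fin d → ℝ) (C : Finset (Fin d))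
    (p : Fin d → I → ℝ) : ℝ :=
  ∑ x ∈ Finset.univ.filter (fun x => ∀ c ∈ C, p c x ≠ 0), ∏ k, p k x ^ α k

/-- The standard basis vector `e_k` of `ℝ^d`. -/
def stdBasis (d : ℕ) (k : Fin d) : Fin d → ℝ := fun j => if j = k then 1 else 0

/-- ℓ¹-distance of vectors. -/
def dist1 {I : Type} [Fintype I] (p q : I → ℝ) : ℝ := ∑ x, |p x - q x|

/-- Dominating-column monotone `Φ_{α,c}(P) = ∑_{x ∈ supp p^(d)} (p^(c) x)^α (p^(d) x)^{1-α}`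
(columns indexed by `Fin (d+1)`, last column `Fin.last d`). -/
def phiDC {I : Type} [Fintype I] (d : ℕ) (α : ℝ) (c : Fin d)
    (p : Fin (d + 1) → I → ℝ) : ℝ :=
  ∑ x ∈ Finset.univ.filter (fun x => p (Fin.last d) x ≠ 0),
    p c.castSucc x ^ α * p (Fin.last d) x ^ (1 - α)

/-- Kullback–Leibler divergence `D₁(p‖q) = ∑_{x ∈ supp p} p x log (p x / q x)`. -/
def D1 {I : Type} [Fintype I] (p q : I → ℝ) : ℝ :=
  ∑ x ∈ Finset.univ.filter (fun x => p x ≠ 0), p x * Real.log (p x / q x)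

/-- Max divergence `D_∞(p‖q) = log max_{x ∈ supp p} p x / q x` (junk value `0` if `p = 0`). -/
def Dinf {I : Type} [Fintype I] (p q : I → ℝ) : ℝ :=
  if h : ∃ x, p x ≠ 0 then
    Real.log ((Finset.univ.filter fun x => p x ≠ 0).sup'
      ⟨h.choose, Finset.mem_filter.mpr ⟨Finset.mem_univ _, h.choose_spec⟩⟩
      fun x => p x / q x)
  else 0

/-- Convex duality for stochastic maps: if every finite decision problem is solved at least as
well by `p` as by `q`, then `q` is the image of `p` under a stochastic matrix. -/
lemma exists_isStoch_of_forall_sum_le {K I J : Type} [Fintype K] [Fintype I] [Fintype J]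
    [Nonempty J] (p : K → I → ℝ) (q : K → J → ℝ)
    (h : ∀ w : J → K → ℝ, ∑ y, ∑ k, w y k * q k y ≤
      ∑ x, Finset.univ.sup' Finset.univ_nonempty (fun y => ∑ k, w y k * p k x)) :
    ∃ T : J → I → ℝ, IsStoch T ∧ ∀ k y, ∑ x, T y x * p k x = q k y := by
  let L : (I → J → ℝ) →ₗ[ℝ] (J → K → ℝ) :=
    { toFun := fun T y k => ∑ x, T x y * p k x
      map_add' := fun S T => by
        ext y k; simp [add_mul, Finset.sum_add_distrib]
      map_smul' := fun c T => by
        ext y k; simp [mul_assoc, Finset.mul_sum] }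
  let S : Set (I → J → ℝ) := Set.pi Set.univ fun _ => stdSimplex ℝ J
  have hScomp : IsCompact S := isCompact_univ_pi fun _ => isCompact_stdSimplex ℝ J
  have hSconv : Convex ℝ S := convex_pi fun _ _ => convex_stdSimplex ℝ J
  have hLcont : Continuous L := L.continuous_of_finiteDimensional
  by_cases hq : (fun y k => q k y) ∈ L '' S
  · obtain ⟨T, hT, hTq⟩ := hq
    refine ⟨fun y x => T x y, ⟨fun y x => (hT x trivial).1 y, fun x => (hT x trivial).2⟩, ?_⟩
    intro k y
    exact congrFun (congrFun hTq y) k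
  · exfalso
    obtain ⟨f, u, hf1, hf2⟩ := geometric_hahn_banach_closed_point
      (hSconv.linear_image L) (hScomp.image hLcont).isClosed hq
    let w : J → K → ℝ := fun y k => f (Pi.single y (Pi.single k 1))
    have hf : ∀ v : J → K → ℝ, f v = ∑ y, ∑ k, w y k * v y k := by
      intro v
      have hv : v = ∑ y, ∑ k, v y k • (Pi.single y (Pi.single k (1 : ℝ)) : J → K → ℝ) := by
        ext y' k'
        simp only [Finset.sum_apply, Pi.smul_apply, smul_eq_mul]
        rw [Finset.sum_eq_single y', Finset.sum_eq_single k']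
        · simp
        · intro k _ hk; simp [hk.symm]
        · simp
        · intro y _ hy
          refine Finset.sum_eq_zero fun k _ => ?_
          rw [Pi.single_eq_of_ne hy.symm]; simp
        · simp
      conv_lhs => rw [hv]
      simp only [map_sum, map_smul, smul_eq_mul]
      exact Finset.sum_congr rfl fun y _ => Finset.sum_congr rfl fun k _ => mul_comm _ _
    have hmax : ∀ x, ∃ y, Finset.univ.sup' Finset.univ_nonempty
        (fun y => ∑ k, w y k * p k x) = ∑ k, w y k * p k x := fun x => by
      obtain ⟨y, _, hy⟩ := Finset.exists_mem_eq_sup' Finset.univ_nonempty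
        (fun y => ∑ k, w y k * p k x)
      exact ⟨y, hy⟩
    choose m hm using hmax
    have hT : (fun x => Pi.single (m x) (1 : ℝ) : I → J → ℝ) ∈ S := fun x _ =>
      single_mem_stdSimplex ℝ (m x)
    have h1 := hf1 _ ⟨_, hT, rfl⟩
    have h2 := h w
    rw [hf] at h1 hf2
    have h3 : ∑ y, ∑ k, w y k * (L fun x => Pi.single (m x) (1 : ℝ)) y k
        = ∑ x, ∑ k, w (m x) k * p k x := by
      change ∑ y, ∑ k, w y k * ∑ x, (Pi.single (m x) (1 : ℝ) : J → ℝ) y * p k x = _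
      simp only [Finset.mul_sum]
      rw [Finset.sum_comm]
      rw [Finset.sum_congr rfl fun k _ => Finset.sum_comm]
      rw [Finset.sum_comm]
      refine Finset.sum_congr rfl fun x _ => Finset.sum_congr rfl fun k _ => ?_
      rw [Finset.sum_eq_single (m x)]
      · simp
      · intro y _ hy; simp [hy]
      · simp
    rw [h3] at h1
    simp only [hm] at h2
    linarith

section ConvexCore

variable {d : ℕ} {F : (Fin d → ℝ) → ℝ}

lemma ConvexOn.map_single_le (hF : ConvexOn ℝ Set.univ F) (h0 : F 0 = 0) (k : Fin d) {s t : ℝ}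
    (hs : 0 ≤ s) (hst : s ≤ t) (ht : 0 < t) :
    F (Pi.single k s) ≤ s / t * F (Pi.single k t) := by
  have h := hF.2 (Set.mem_univ (Pi.single k t)) (Set.mem_univ 0) (div_nonneg hs ht.le)
    (sub_nonneg.2 ((div_le_one ht).2 hst)) (by ring)
  have e : (s / t) • (Pi.single k t : Fin d → ℝ) + (1 - s / t) • (0 : Fin d → ℝ)
      = Pi.single k s := by
    rw [smul_zero, add_zero, ← Pi.single_smul, smul_eq_mul, div_mul_cancel₀ _ ht.ne']
  rw [e, h0] at h
  simpa using h

/-- The positive part of a function along the `k`-th axis. -/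
def axisPos (F : (Fin d → ℝ) → ℝ) (k : Fin d) (s : ℝ) : ℝ := max (F (Pi.single k s)) 0

lemma axisPos_nonneg (k : Fin d) (s : ℝ) : 0 ≤ axisPos F k s := le_max_right _ _

lemma axisPos_le_div_mul (hF : ConvexOn ℝ Set.univ F) (h0 : F 0 = 0) (k : Fin d) {s t : ℝ}
    (hs : 0 ≤ s) (hst : s ≤ t) (ht : 0 < t) :
    axisPos F k s ≤ s / t * axisPos F k t := by
  have h1 : 0 ≤ s / t := div_nonneg hs ht.le
  refine max_le ((hF.map_single_le h0 k hs hst ht).trans ?_) (mul_nonneg h1 (axisPos_nonneg k t))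
  exact mul_le_mul_of_nonneg_left (le_max_left _ _) h1

lemma axisPos_mono (hF : ConvexOn ℝ Set.univ F) (h0 : F 0 = 0) (k : Fin d) {s t : ℝ}
    (hs : 0 ≤ s) (hst : s ≤ t) : axisPos F k s ≤ axisPos F k t := by
  rcases (hs.trans hst).eq_or_lt with ht | ht
  · rw [le_antisymm hst (ht ▸ hs)]
  · refine (axisPos_le_div_mul hF h0 k hs hst ht).trans ?_
    exact mul_le_of_le_one_left (axisPos_nonneg k t) ((div_le_one ht).2 hst)

lemma axisPos_eq_zero (hF : ConvexOn ℝ Set.univ F) (h0 : F 0 = 0)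
    (h1 : ∀ k, F (Pi.single k 1) = 0) (k : Fin d) {s : ℝ} (hs : 0 ≤ s) (hs1 : s ≤ 1) :
    axisPos F k s = 0 := by
  refine le_antisymm ?_ (axisPos_nonneg k s)
  have h := axisPos_le_div_mul hF h0 k hs hs1 one_pos
  simpa [axisPos, h1] using h

lemma ConvexOn.le_sum_axisPos (hd : 1 ≤ d) (hF : ConvexOn ℝ Set.univ F) (y : Fin d → ℝ) :
    F y ≤ ∑ k, axisPos F k (d * y k) := by
  have hd0 : (0 : ℝ) < d := by exact_mod_cast hd
  have hd1 : (1 : ℝ) ≤ d := by exact_mod_cast hd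
  have h := hF.map_sum_le (t := Finset.univ) (w := fun _ : Fin d => 1 / (d : ℝ))
    (p := fun k => (Pi.single k (d * y k) : Fin d → ℝ)) (fun _ _ => by positivity)
    (by simp [hd0.ne']) (fun _ _ => Set.mem_univ _)
  have e : ∑ k, (1 / (d : ℝ)) • (Pi.single k (d * y k) : Fin d → ℝ) = y := by
    ext l
    simp only [Finset.sum_apply, Pi.smul_apply, smul_eq_mul, Pi.single_apply]
    rw [Finset.sum_eq_single l] <;> simp +contextual [hd0.ne', eq_comm]
  rw [e] at h
  refine h.trans (Finset.sum_le_sum fun k _ => ?_)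
  calc (1 / (d : ℝ)) • F (Pi.single k (d * y k)) ≤ 1 / (d : ℝ) * axisPos F k (d * y k) :=
        mul_le_mul_of_nonneg_left (le_max_left _ _) (by positivity)
    _ ≤ axisPos F k (d * y k) :=
        mul_le_of_le_one_left (axisPos_nonneg _ _) ((div_le_one hd0).2 hd1)

lemma ConvexOn.le_mul_add_sum_axisPos (hd : 1 ≤ d) (hF : ConvexOn ℝ Set.univ F) (h0 : F 0 = 0)
    {x z : Fin d → ℝ} {t : ℝ} (hx : ∀ k, 0 ≤ x k) (ht0 : 0 ≤ t) (ht : t ≤ 1 / 2)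
    (hxz : ∀ k, t * x k ≤ z k) :
    F z ≤ t * F x + ∑ k, axisPos F k (2 * d * z k) := by
  have hd0 : (0 : ℝ) < d := by exact_mod_cast hd
  set y : Fin d → ℝ := fun k => (z k - t * x k) / (1 - t) with hy
  have ht1 : 0 < 1 - t := by linarith
  have e : z = t • x + (1 - t) • y := by
    ext k
    simp only [hy, Pi.add_apply, Pi.smul_apply, smul_eq_mul]
    field_simp
    ring
  have h := hF.2 (Set.mem_univ x) (Set.mem_univ y) ht0 ht1.le (by ring)
  rw [← e] at h
  have hyF := hF.le_sum_axisPos hd y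
  have hsum : ∑ k, axisPos F k (d * y k) ≤ ∑ k, axisPos F k (2 * d * z k) := by
    refine Finset.sum_le_sum fun k _ => axisPos_mono hF h0 k ?_ ?_
    · exact mul_nonneg hd0.le (div_nonneg (sub_nonneg.2 (hxz k)) ht1.le)
    · have : y k ≤ 2 * z k := by
        have hz : 0 ≤ z k := (mul_nonneg ht0 (hx k)).trans (hxz k)
        have := mul_nonneg ht0 (hx k)
        rw [hy, div_le_iff₀ ht1]
        nlinarith
      nlinarith
  have hnn : 0 ≤ ∑ k, axisPos F k (2 * d * z k) := Finset.sum_nonneg fun k _ => axisPos_nonneg _ _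
  simp only [smul_eq_mul] at h
  nlinarith

lemma sum_axisPos_le {I J : Type} [Fintype I] [Fintype J] (hd : 1 ≤ d)
    (hF : ConvexOn ℝ Set.univ F) (h0 : F 0 = 0) (h1 : ∀ k, F (Pi.single k 1) = 0)
    {a : I → ℝ} {z : I → Fin d → ℝ} {b : J → ℝ} {u : J → Fin d → ℝ}
    (ha : ∀ i, 0 ≤ a i) (hb : ∀ j, 0 ≤ b j) (hu : ∀ j k, 0 ≤ u j k)
    {M : ℝ} (k : Fin d) (hV : ((Finset.univ.image fun j => u j k).card : ℝ) ≤ M)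
    (hA : ∀ x : ℝ, 1 ≤ x →
      2 * d ^ 2 * M * ∑ j with x ≤ 2 * d * u j k, b j * u j k ≤
        ∑ i with (∀ l, l ≠ k → z i l = 0) ∧ x ≤ z i k, a i * z i k) :
    d * ∑ j, b j * axisPos F k (2 * d * u j k) ≤ ∑ i, a i * max (F (z i)) 0 := by
  have hd0 : (0 : ℝ) < d := by exact_mod_cast hd
  set R := ∑ i, a i * max (F (z i)) 0 with hR
  have hR0 : 0 ≤ R := Finset.sum_nonneg fun i _ => mul_nonneg (ha i) (le_max_right _ _)
  have hM : 0 ≤ M := (Nat.cast_nonneg _).trans hV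
  have key : ∀ v : ℝ, 0 ≤ v →
      d * M * ∑ j with u j k = v, b j * axisPos F k (2 * d * u j k) ≤ R := by
    intro v hv
    rcases le_or_gt (2 * d * v) 1 with hv1 | hv1
    · rw [Finset.sum_eq_zero]
      · simpa using hR0
      · intro j hj
        rw [(Finset.mem_filter.1 hj).2, axisPos_eq_zero hF h0 h1 k (by positivity) hv1, mul_zero]
    · set x := 2 * d * v with hx
      have hx0 : 0 < x := by linarith
      have hA' := hA x hv1.le
      have e1 : d * M * ∑ j with u j k = v, b j * axisPos F k (2 * d * u j k)
          = axisPos F k x / x * (2 * d ^ 2 * M * ∑ j with u j k = v, b j * u j k) := by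
        rw [Finset.mul_sum, Finset.mul_sum, Finset.mul_sum]
        refine Finset.sum_congr rfl fun j hj => ?_
        rw [(Finset.mem_filter.1 hj).2, ← hx]
        field_simp
        rw [hx]; ring
      have e2 : ∑ j with u j k = v, b j * u j k ≤ ∑ j with x ≤ 2 * d * u j k, b j * u j k := by
        refine Finset.sum_le_sum_of_subset_of_nonneg ?_ fun j _ _ => mul_nonneg (hb j) (hu j k)
        intro j hj
        rw [Finset.mem_filter] at hj ⊢
        exact ⟨Finset.mem_univ _, by rw [hj.2]⟩
      rw [e1]
      calc axisPos F k x / x * (2 * d ^ 2 * M * ∑ j with u j k = v, b j * u j k)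
          ≤ axisPos F k x / x *
              ∑ i with (∀ l, l ≠ k → z i l = 0) ∧ x ≤ z i k, a i * z i k := by
            refine mul_le_mul_of_nonneg_left ?_ (div_nonneg (axisPos_nonneg _ _) hx0.le)
            exact (mul_le_mul_of_nonneg_left e2 (by positivity)).trans hA'
        _ ≤ ∑ i with (∀ l, l ≠ k → z i l = 0) ∧ x ≤ z i k, a i * max (F (z i)) 0 := by
            rw [Finset.mul_sum]
            refine Finset.sum_le_sum fun i hi => ?_
            obtain ⟨-, hi1, hi2⟩ := Finset.mem_filter.1 hi
            have hzi : z i = Pi.single k (z i k) := by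
              ext l
              by_cases hl : l = k
              · subst hl; simp
              · rw [hi1 l hl, Pi.single_eq_of_ne hl]
            have hz0 : 0 < z i k := hx0.trans_le hi2
            have h2 := axisPos_le_div_mul hF h0 k hx0.le hi2 hz0
            have h3 : axisPos F k x / x * z i k ≤ axisPos F k (z i k) := by
              rw [div_mul_eq_mul_div, div_le_iff₀ hx0]
              calc axisPos F k x * z i k ≤ x / z i k * axisPos F k (z i k) * z i k :=
                    mul_le_mul_of_nonneg_right h2 hz0.le
                _ = axisPos F k (z i k) * x := by field_simp
            have h4 : max (F (z i)) 0 = axisPos F k (z i k) := by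
              rw [axisPos, ← hzi]
            rw [h4]
            calc axisPos F k x / x * (a i * z i k) = a i * (axisPos F k x / x * z i k) := by ring
              _ ≤ _ := mul_le_mul_of_nonneg_left h3 (ha i)
        _ ≤ R := Finset.sum_le_sum_of_subset_of_nonneg (Finset.filter_subset _ _)
            fun i _ _ => mul_nonneg (ha i) (le_max_right _ _)
  set V := Finset.univ.image fun j => u j k with hVdef
  have hfib : ∑ j, b j * axisPos F k (2 * d * u j k)
      = ∑ v ∈ V, ∑ j with u j k = v, b j * axisPos F k (2 * d * u j k) :=
    (Finset.sum_fiberwise_of_maps_to (fun j _ => Finset.mem_image_of_mem _ (Finset.mem_univ j))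
      _).symm
  have hsum : d * M * ∑ j, b j * axisPos F k (2 * d * u j k) ≤ V.card * R := by
    rw [hfib, Finset.mul_sum, ← nsmul_eq_mul V.card R]
    refine Finset.sum_le_card_nsmul V _ _ fun v hv => ?_
    obtain ⟨j, -, rfl⟩ := Finset.mem_image.1 hv
    exact key _ (hu j k)
  rcases hM.eq_or_lt with hM0 | hM0
  · have hV0 : V = ∅ := by
      rw [← Finset.card_eq_zero]
      have : (V.card : ℝ) ≤ 0 := by rw [hM0]; exact hV
      exact_mod_cast le_antisymm this (Nat.cast_nonneg _)
    rw [hfib, hV0]; simpa using hR0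
  · have : M * (d * ∑ j, b j * axisPos F k (2 * d * u j k)) ≤ M * R := by
      calc M * (d * ∑ j, b j * axisPos F k (2 * d * u j k))
          = d * M * ∑ j, b j * axisPos F k (2 * d * u j k) := by ring
        _ ≤ V.card * R := hsum
        _ ≤ M * R := mul_le_mul_of_nonneg_right hV hR0
    exact le_of_mul_le_mul_left this hM0

/-- Comparison of two weighted families of points of the orthant on a convex function that
vanishes at the origin and at the unit vectors. The hypotheses compare the tails along the axes
and the masses of the points of the first family, with a slack that exceeds the number `M` of
distinct points. -/
lemma sum_mul_le_sum_mul_of_tails {I J : Type} [Fintype I] [Fintype J] (hd : 1 ≤ d)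
    (hF : ConvexOn ℝ Set.univ F) (h0 : F 0 = 0) (h1 : ∀ k, F (Pi.single k 1) = 0)
    {a : I → ℝ} {z : I → Fin d → ℝ} {b : J → ℝ} {u : J → Fin d → ℝ}
    (ha : ∀ i, 0 ≤ a i) (hb : ∀ j, 0 ≤ b j) (hz : ∀ i k, 0 ≤ z i k) (hu : ∀ j k, 0 ≤ u j k)
    {M : ℝ} (hX : ((Finset.univ.image z).card : ℝ) ≤ M)
    (hV : ∀ k, ((Finset.univ.image fun j => u j k).card : ℝ) ≤ M)
    (hA : ∀ k, ∀ x : ℝ, 1 ≤ x →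
      2 * d ^ 2 * M * ∑ j with x ≤ 2 * d * u j k, b j * u j k ≤
        ∑ i with (∀ l, l ≠ k → z i l = 0) ∧ x ≤ z i k, a i * z i k)
    (hB : ∀ i, z i ≠ 0 → (∀ k, (∀ l, l ≠ k → z i l = 0) → z i k < 1) →
      ∃ c : J → ℝ, (∀ j, 0 ≤ c j) ∧ (∀ j, c j ≤ b j) ∧ (∀ j k, c j * z i k ≤ b j * u j k) ∧
        2 * M * ∑ i' with z i' = z i, a i' ≤ ∑ j, c j) :
    ∑ j, b j * F (u j) ≤ ∑ i, a i * F (z i) := by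
  have hd0 : (0 : ℝ) < d := by exact_mod_cast hd
  have hM : 0 ≤ M := (Nat.cast_nonneg _).trans hX
  set R := ∑ i, a i * max (F (z i)) 0 with hR
  set E := ∑ j, b j * ∑ k, axisPos F k (2 * d * u j k) with hE
  have hER : E ≤ R := by
    have h2 : E = ∑ k, ∑ j, b j * axisPos F k (2 * d * u j k) := by
      simp only [hE, Finset.mul_sum]
      exact Finset.sum_comm
    have h3 : d * E ≤ d * R := by
      rw [h2, Finset.mul_sum]
      calc ∑ k, d * ∑ j, b j * axisPos F k (2 * d * u j k) ≤ ∑ _k : Fin d, R :=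
            Finset.sum_le_sum fun k _ => sum_axisPos_le hd hF h0 h1 ha hb hu k (hV k) (hA k)
        _ = d * R := by simp
    exact le_of_mul_le_mul_left h3 hd0
  set X := Finset.univ.image z with hXdef
  set m : (Fin d → ℝ) → ℝ := fun x => max (-F x) 0 * ∑ i with z i = x, a i with hm
  have hneg : ∑ i, a i * max (-F (z i)) 0 = ∑ x ∈ X, m x := by
    rw [← Finset.sum_fiberwise_of_maps_to
      (fun i _ => Finset.mem_image_of_mem z (Finset.mem_univ i))]
    refine Finset.sum_congr rfl fun x _ => ?_
    simp only [hm, Finset.mul_sum]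
    refine Finset.sum_congr rfl fun i hi => ?_
    rw [(Finset.mem_filter.1 hi).2, mul_comm]
  have hsplit : ∑ i, a i * F (z i) = R - ∑ i, a i * max (-F (z i)) 0 := by
    rw [hR, ← Finset.sum_sub_distrib]
    refine Finset.sum_congr rfl fun i _ => ?_
    rw [← mul_sub, max_comm, max_comm _ (0 : ℝ)]
    congr 1
    rcases le_total (F (z i)) 0 with h | h
    · rw [max_eq_left h, max_eq_right (neg_nonneg.2 h)]; ring
    · rw [max_eq_right h, max_eq_left (neg_nonpos.2 h)]; ring
  by_cases hpos : ∃ x ∈ X, F x < 0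
  · obtain ⟨x, hx, hmx⟩ := Finset.exists_max_image X m ⟨_, hpos.choose_spec.1⟩
    have hbound : ∑ x ∈ X, m x ≤ M * m x := by
      calc ∑ x ∈ X, m x ≤ X.card • m x := Finset.sum_le_card_nsmul _ _ _ hmx
        _ = X.card * m x := nsmul_eq_mul _ _
        _ ≤ M * m x := mul_le_mul_of_nonneg_right hX
            (mul_nonneg (le_max_right _ _) (Finset.sum_nonneg fun i _ => ha i))
    rcases lt_or_ge (F x) 0 with hFx | hFx
    · obtain ⟨i, -, rfl⟩ := Finset.mem_image.1 hx
      obtain ⟨c, hc0, hcb, hcz, hcs⟩ := hB i (fun h => by rw [h, h0] at hFx; exact hFx.false)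
        (fun k hk => by
          by_contra! hcon
          have hzi : z i = Pi.single k (z i k) := by
            ext l
            by_cases hl : l = k
            · subst hl; simp
            · rw [hk l hl, Pi.single_eq_of_ne hl]
          have hpos' : 0 < z i k := one_pos.trans_le hcon
          have := hF.map_single_le h0 k zero_le_one hcon hpos'
          rw [h1, ← hzi] at this
          have h3 : 0 < 1 / z i k := by positivity
          nlinarith)
      have hterm : ∀ j, b j * F (u j) ≤
          c j / 2 * F (z i) + b j * ∑ k, axisPos F k (2 * d * u j k) := by
        intro j
        rcases (hb j).eq_or_lt with hj | hj
        · have : c j = 0 := le_antisymm (hj ▸ hcb j) (hc0 j)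
          simp [← hj, this]
        · have := hF.le_mul_add_sum_axisPos hd h0 (hz i) (z := u j) (t := c j / (2 * b j))
            (div_nonneg (hc0 j) (by linarith))
            (by rw [div_le_iff₀ (by linarith)]; linarith [hcb j])
            (fun k => by
              rw [div_mul_eq_mul_div, div_le_iff₀ (by linarith)]
              nlinarith [hcz j k, mul_nonneg hj.le (hu j k)])
          calc b j * F (u j) ≤ b j * (c j / (2 * b j) * F (z i)
                + ∑ k, axisPos F k (2 * d * u j k)) := mul_le_mul_of_nonneg_left this hj.le
            _ = _ := by field_simp
      have hsum : ∑ j, b j * F (u j) ≤ (∑ j, c j) / 2 * F (z i) + E := by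
        calc ∑ j, b j * F (u j) ≤ ∑ j, (c j / 2 * F (z i)
              + b j * ∑ k, axisPos F k (2 * d * u j k)) := Finset.sum_le_sum fun j _ => hterm j
          _ = _ := by rw [Finset.sum_add_distrib, ← Finset.sum_mul, ← Finset.sum_div]
      have hmz : m (z i) = -F (z i) * ∑ i' with z i' = z i, a i' := by
        rw [hm]; simp only; rw [max_eq_left (by linarith)]
      rw [hsplit, hneg]
      rw [hmz] at hbound
      nlinarith
    · have : m x = 0 := by rw [hm]; simp only; rw [max_eq_right (by linarith), zero_mul]
      obtain ⟨x', hx', hFx'⟩ := hpos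
      have hz0 : ∑ x ∈ X, m x ≤ 0 := by rw [this] at hbound; linarith
      have hsum : ∑ j, b j * F (u j) ≤ E := by
        refine Finset.sum_le_sum fun j _ => mul_le_mul_of_nonneg_left ?_ (hb j)
        have := hF.le_mul_add_sum_axisPos hd h0 (x := 0) (z := u j) (t := 0) (by simp) le_rfl
          (by norm_num) (by simpa using hu j)
        simpa using this
      rw [hsplit, hneg]
      linarith
  · push Not at hpos
    have hz0 : ∑ x ∈ X, m x = 0 := Finset.sum_eq_zero fun x hx => by
      rw [hm]; simp only; rw [max_eq_right (by linarith [hpos x hx]), zero_mul]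
    have hsum : ∑ j, b j * F (u j) ≤ E := by
      refine Finset.sum_le_sum fun j _ => mul_le_mul_of_nonneg_left ?_ (hb j)
      have := hF.le_mul_add_sum_axisPos hd h0 (x := 0) (z := u j) (t := 0) (by simp) le_rfl
        (by norm_num) (by simpa using hu j)
      simpa using this
    rw [hsplit, hneg]
    linarith

end ConvexCore

lemma kpow_nonneg {I : Type} {p : I → ℝ} (hp : ∀ x, 0 ≤ p x) (n : ℕ) (f : Fin n → I) :
    0 ≤ kpow p n f :=
  Finset.prod_nonneg fun _ _ => hp _

lemma kpow_ne_zero_iff {I : Type} {p : I → ℝ} {n : ℕ} {f : Fin n → I} :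
    kpow p n f ≠ 0 ↔ ∀ j, p (f j) ≠ 0 := by
  simp [kpow, Finset.prod_ne_zero_iff]

section ProductWeights

variable {I : Type} [Fintype I]

lemma sum_kpow (p : I → ℝ) (n : ℕ) : ∑ f, kpow p n f = (∑ x, p x) ^ n :=
  (Fintype.sum_pow p n).symm

lemma IsProb.sum_kpow {p : I → ℝ} (hp : IsProb p) (n : ℕ) : ∑ f, kpow p n f = 1 := by
  rw [_root_.sum_kpow, hp.2, one_pow]

lemma sum_kpow_mul_sq {w : I → ℝ} (hw : IsProb w) {X : I → ℝ} (hX : ∑ x, w x * X x = 0) (n : ℕ) :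
    ∑ f, kpow w n f * (∑ j, X (f j)) ^ 2 = n * ∑ x, w x * X x ^ 2 := by
  induction n with
  | zero => simp
  | succ n ih =>
    rw [← (Fin.consEquiv fun _ => I).sum_comp, Fintype.sum_prod_type]
    have e : ∀ (x : I) (f : Fin n → I), kpow w (n + 1) (Fin.consEquiv (fun _ => I) (x, f)) *
        (∑ j, X (Fin.consEquiv (fun _ => I) (x, f) j)) ^ 2 =
        w x * X x ^ 2 * kpow w n f + 2 * (w x * X x) * (kpow w n f * ∑ j, X (f j)) +
          w x * (kpow w n f * (∑ j, X (f j)) ^ 2) := by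
      intro x f
      simp only [kpow, Fin.consEquiv_apply, Fin.prod_univ_succ, Fin.sum_univ_succ, Fin.cons_zero,
        Fin.cons_succ]
      ring
    simp only [e, Finset.sum_add_distrib, ← Finset.mul_sum, ← Finset.sum_mul]
    rw [hw.sum_kpow, ih, hX, hw.2]
    push_cast
    ring

/-- Chebyshev's inequality for finitely many centred variables, uniformly over the law. -/
lemma eventually_le_sum_kpow_filter (K : Type) [Fintype K] (B : ℝ) {ε η : ℝ} (hε : 0 < ε)
    (hη : 0 < η) : ∀ᶠ n : ℕ in Filter.atTop, ∀ (w : I → ℝ) (X : K → I → ℝ), IsProb w →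
      (∀ k, ∑ x, w x * X k x = 0) → (∀ k x, |X k x| ≤ B) →
      1 - η ≤ ∑ f with ∀ k, |∑ j, X k (f j)| < n * ε, kpow w n f := by
  have hlim : Filter.Tendsto (fun n : ℕ => Fintype.card K * (B ^ 2 / ε ^ 2) / (n : ℝ))
      Filter.atTop (nhds 0) := tendsto_const_div_atTop_nhds_zero_nat _
  filter_upwards [hlim.eventually_lt_const hη, Filter.eventually_ge_atTop 1] with n hn hn1
  intro w X hw hX hB
  have hn0 : (0 : ℝ) < n := by exact_mod_cast hn1
  have hbad : ∀ k, ∑ f with ¬ |∑ j, X k (f j)| < n * ε, kpow w n f ≤ B ^ 2 / ε ^ 2 / n := by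
    intro k
    have h1 : ∑ f with ¬ |∑ j, X k (f j)| < n * ε, kpow w n f * (n * ε) ^ 2 ≤
        n * ∑ x, w x * X k x ^ 2 := by
      rw [← sum_kpow_mul_sq hw (hX k)]
      refine (Finset.sum_le_sum fun f hf => ?_).trans
        (Finset.sum_le_sum_of_subset_of_nonneg (Finset.filter_subset _ _)
          fun f _ _ => mul_nonneg (kpow_nonneg hw.1 n f) (sq_nonneg _))
      refine mul_le_mul_of_nonneg_left ?_ (kpow_nonneg hw.1 n f)
      rw [sq_le_sq, abs_of_nonneg (by positivity : 0 ≤ n * ε)]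
      exact not_lt.1 (Finset.mem_filter.1 hf).2
    have h2 : ∑ x, w x * X k x ^ 2 ≤ B ^ 2 := by
      calc ∑ x, w x * X k x ^ 2 ≤ ∑ x, w x * B ^ 2 := Finset.sum_le_sum fun x _ =>
            mul_le_mul_of_nonneg_left (sq_le_sq' (abs_le.1 (hB k x)).1 (abs_le.1 (hB k x)).2)
              (hw.1 x)
        _ = B ^ 2 := by rw [← Finset.sum_mul, hw.2, one_mul]
    rw [← Finset.sum_mul] at h1
    rw [div_div, le_div_iff₀ (by positivity)]
    refine le_of_mul_le_mul_left ?_ hn0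
    calc (n : ℝ) * ((∑ f with ¬ |∑ j, X k (f j)| < n * ε, kpow w n f) * (ε ^ 2 * n))
        = (∑ f with ¬ |∑ j, X k (f j)| < n * ε, kpow w n f) * (n * ε) ^ 2 := by ring
      _ ≤ n * ∑ x, w x * X k x ^ 2 := h1
      _ ≤ n * B ^ 2 := mul_le_mul_of_nonneg_left h2 hn0.le
  have htot : ∑ f with ¬ ∀ k, |∑ j, X k (f j)| < n * ε, kpow w n f ≤ η := by
    calc ∑ f with ¬ ∀ k, |∑ j, X k (f j)| < n * ε, kpow w n f
        ≤ ∑ f, ∑ k : K, if ¬ |∑ j, X k (f j)| < n * ε then kpow w n f else 0 := by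
          have hnn : ∀ (f : Fin n → I) (k : K),
              0 ≤ if ¬ |∑ j, X k (f j)| < n * ε then kpow w n f else 0 := fun f k => by
            split_ifs
            exacts [le_rfl, kpow_nonneg hw.1 n f]
          rw [Finset.sum_filter]
          refine Finset.sum_le_sum fun f _ => ?_
          by_cases hf : ∀ k, |∑ j, X k (f j)| < n * ε
          · rw [if_neg (not_not.2 hf)]
            exact Finset.sum_nonneg fun k _ => hnn f k
          · rw [if_pos hf]
            obtain ⟨k, hk⟩ := not_forall.1 hf
            refine le_trans (le_of_eq ?_)
              (Finset.single_le_sum (fun k _ => hnn f k) (Finset.mem_univ k))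
            rw [if_pos hk]
      _ = ∑ k : K, ∑ f with ¬ |∑ j, X k (f j)| < n * ε, kpow w n f := by
          rw [Finset.sum_comm]
          exact Finset.sum_congr rfl fun k _ => (Finset.sum_filter _ _).symm
      _ ≤ ∑ _k : K, B ^ 2 / ε ^ 2 / n := Finset.sum_le_sum fun k _ => hbad k
      _ = Fintype.card K * (B ^ 2 / ε ^ 2) / n := by simp; ring
      _ ≤ η := hn.le
  have := Finset.sum_filter_add_sum_filter_not Finset.univ
    (fun f : Fin n → I => ∀ k, |∑ j, X k (f j)| < n * ε) (kpow w n)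
  rw [hw.sum_kpow] at this
  linarith

lemma prod_comp_eq_prod_pow_card {n : ℕ} (y : I → ℝ) (f : Fin n → I) :
    ∏ j, y (f j) = ∏ x, y x ^ (Finset.univ.filter fun j => f j = x).card := by
  rw [← Finset.prod_fiberwise Finset.univ f]
  refine Finset.prod_congr rfl fun x _ => ?_
  rw [Finset.prod_congr rfl fun j hj => by rw [(Finset.mem_filter.1 hj).2], Finset.prod_const]

/-- A function of words that only depends on letter frequencies has polynomially many values. -/
lemma card_image_le_of_count {n : ℕ} {β : Type*} (G : (Fin n → I) → β)
    (hG : ∀ f g : Fin n → I, (∀ x, (Finset.univ.filter fun j => f j = x).card =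
      (Finset.univ.filter fun j => g j = x).card) → G f = G g) :
    (Finset.univ.image G).card ≤ (n + 1) ^ Fintype.card I := by
  let c : (Fin n → I) → I → Fin (n + 1) := fun f x =>
    ⟨(Finset.univ.filter fun j => f j = x).card,
      Nat.lt_succ_of_le ((Finset.card_filter_le _ _).trans (by simp))⟩
  have hGc : ∀ f g, c f = c g → G f = G g := fun f g h => hG f g fun x =>
    congrArg Fin.val (congrFun h x)
  obtain ⟨H, hH⟩ : ∃ H : (I → Fin (n + 1)) → Option β, ∀ f, H (c f) = some (G f) := by
    refine ⟨fun m => if h : ∃ f, c f = m then some (G h.choose) else none, fun f => ?_⟩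
    have h : ∃ f', c f' = c f := ⟨f, rfl⟩
    simp only [h, dif_pos, Option.some.injEq]
    exact hGc _ _ h.choose_spec
  calc (Finset.univ.image G).card = (Finset.univ.image fun f => H (c f)).card := by
        simp only [hH]
        rw [← Finset.card_image_of_injective _ (Option.some_injective β), Finset.image_image]
        rfl
    _ ≤ (Finset.univ.image c).card := by
        rw [← Function.comp_def, ← Finset.image_image]
        exact Finset.card_image_le
    _ ≤ Fintype.card (I → Fin (n + 1)) := Finset.card_le_univ _
    _ = (n + 1) ^ Fintype.card I := by simp

end ProductWeights

lemma eventually_mul_pow_le_exp (C : ℝ) (D : ℕ) {δ : ℝ} (hδ : 0 < δ) :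
    ∀ᶠ n : ℕ in Filter.atTop, C * ((n : ℝ) + 1) ^ D ≤ Real.exp (n * δ) := by
  have h1 := (Real.tendsto_pow_mul_exp_neg_atTop_nhds_zero D).comp
    ((Filter.tendsto_atTop_add_const_right _ 1 tendsto_natCast_atTop_atTop).const_mul_atTop hδ)
  have h2 := h1.const_mul (C / δ ^ D * Real.exp δ)
  rw [mul_zero] at h2
  filter_upwards [h2.eventually_le_const one_pos] with n hn
  simp only [Function.comp_apply] at hn
  have e : C / δ ^ D * Real.exp δ * ((δ * ((n : ℝ) + 1)) ^ D * Real.exp (-(δ * ((n : ℝ) + 1))))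
      = C * ((n : ℝ) + 1) ^ D * Real.exp (-(n * δ)) := by
    rw [show -(δ * ((n : ℝ) + 1)) = -(n * δ) + -δ by ring, Real.exp_add, Real.exp_neg δ, mul_pow]
    field_simp
  rw [e, Real.exp_neg, ← div_eq_mul_inv, div_le_one (Real.exp_pos _)] at hn
  exact hn

lemma HasDerivAt.exists_lt_of_neg {φ : ℝ → ℝ} {φ' a δ : ℝ} (h : HasDerivAt φ φ' a) (hφ : φ' < 0)
    (hδ : 0 < δ) : ∃ t, a < t ∧ t < a + δ ∧ φ t < φ a := by
  have h1 := (hasDerivAt_iff_tendsto_slope.1 h).eventually_lt_const hφ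
  have h2 : ∀ᶠ t in nhdsWithin a (Set.Ioi a), slope φ a t < 0 :=
    h1.filter_mono (nhdsWithin_mono _ fun t ht => ne_of_gt ht)
  have h3 : ∀ᶠ t in nhdsWithin a (Set.Ioi a), t ∈ Set.Ioo a (a + δ) :=
    Ioo_mem_nhdsGT (by linarith)
  obtain ⟨t, ht1, ht2⟩ := (h2.and h3).exists
  refine ⟨t, ht2.1, ht2.2, ?_⟩
  have h4 : 0 < t - a := sub_pos.2 ht2.1
  rw [slope_def_field, div_neg_iff] at ht1
  rcases ht1 with h5 | h5 <;> linarith [h5.1, h5.2]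

section Tilting

variable {K J : Type} [Fintype K]

/-- First-order optimality condition for the minimum of an exponential sum on the simplex. -/
lemma exists_stdSimplex_tilt_nonneg [Nonempty K] (s : Finset J) (ℓ : K → J → ℝ) :
    ∃ α ∈ stdSimplex ℝ K, ∀ k,
      0 ≤ ∑ y ∈ s, Real.exp (∑ l, α l * ℓ l y) * (ℓ k y - ∑ l, α l * ℓ l y) := by
  obtain ⟨α, hα, hmin⟩ := (isCompact_stdSimplex ℝ K).exists_isMinOn
    ⟨_, single_mem_stdSimplex ℝ (Classical.arbitrary K)⟩
    (f := fun α : K → ℝ => ∑ y ∈ s, Real.exp (∑ l, α l * ℓ l y))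
    (Continuous.continuousOn (by fun_prop))
  refine ⟨α, hα, fun k => ?_⟩
  by_contra! hneg
  set A : J → ℝ := fun y => ∑ l, α l * ℓ l y with hA
  have hder : HasDerivAt (fun t : ℝ => ∑ y ∈ s, Real.exp (A y + t * (ℓ k y - A y)))
      (∑ y ∈ s, Real.exp (A y) * (ℓ k y - A y)) 0 := by
    refine HasDerivAt.fun_sum fun y _ => ?_
    have h1 : HasDerivAt (fun t : ℝ => A y + t * (ℓ k y - A y)) (1 * (ℓ k y - A y)) 0 :=
      ((hasDerivAt_id 0).mul_const _).const_add _
    simpa using h1.exp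
  obtain ⟨t, ht0, ht1, hlt⟩ := hder.exists_lt_of_neg hneg one_pos
  rw [zero_add] at ht1
  have hmem : (1 - t) • α + t • (Pi.single k 1 : K → ℝ) ∈ stdSimplex ℝ K :=
    convex_stdSimplex ℝ K hα (single_mem_stdSimplex ℝ k) (by linarith) ht0.le (by ring)
  have hle := isMinOn_iff.1 hmin _ hmem
  have e : ∀ y, ∑ l, ((1 - t) • α + t • (Pi.single k 1 : K → ℝ)) l * ℓ l y
      = A y + t * (ℓ k y - A y) := by
    intro y
    simp only [Pi.add_apply, Pi.smul_apply, smul_eq_mul, add_mul, Finset.sum_add_distrib,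
      mul_assoc, ← Finset.mul_sum, Pi.single_apply, ite_mul, one_mul, zero_mul,
      Finset.sum_ite_eq', Finset.mem_univ, if_true]
    simp only [hA]
    ring
  simp only [e] at hle
  simp only [zero_mul, add_zero] at hlt
  exact absurd hlt (not_lt.2 hle)

variable [Fintype J]

/-- The partition function `∑_y ∏_k (q k y) ^ α k`, summed over the common support of the `q k`. -/
def partitionFn (q : K → J → ℝ) (α : K → ℝ) : ℝ :=
  ∑ y with ∀ k, q k y ≠ 0, Real.exp (∑ k, α k * Real.log (q k y))

lemma continuous_partitionFn (q : K → J → ℝ) : Continuous (partitionFn q) := by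
  unfold partitionFn
  fun_prop

lemma partitionFn_pos {q : K → J → ℝ} (hq : ∃ y, ∀ k, q k y ≠ 0) (α : K → ℝ) :
    0 < partitionFn q α :=
  Finset.sum_pos (fun _ _ => Real.exp_pos _)
    (hq.imp fun y hy => Finset.mem_filter.2 ⟨Finset.mem_univ y, hy⟩)

lemma exists_forall_abs_log_le (q : K → J → ℝ) : ∃ B, ∀ k y, |Real.log (q k y)| ≤ B :=
  ⟨∑ k, ∑ y, |Real.log (q k y)|, fun k y =>
    (Finset.single_le_sum (fun _ _ => abs_nonneg _) (Finset.mem_univ y)).trans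
      (Finset.single_le_sum (f := fun k => ∑ y, |Real.log (q k y)|)
        (fun _ _ => Finset.sum_nonneg fun _ _ => abs_nonneg _) (Finset.mem_univ k))⟩

lemma abs_sum_mul_le {ι : Type} [Fintype ι] {w X : ι → ℝ} {B : ℝ} (hw : ∀ i, 0 ≤ w i)
    (hw1 : ∑ i, w i = 1) (hX : ∀ i, |X i| ≤ B) : |∑ i, w i * X i| ≤ B := by
  calc |∑ i, w i * X i| ≤ ∑ i, |w i * X i| := Finset.abs_sum_le_sum_abs _ _
    _ ≤ ∑ i, w i * B := Finset.sum_le_sum fun i _ => by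
        rw [abs_mul, abs_of_nonneg (hw i)]
        exact mul_le_mul_of_nonneg_left (hX i) (hw i)
    _ = B := by rw [← Finset.sum_mul, hw1, one_mul]

/-- Multivariate Chernoff lower bound: up to subexponential factors, the total minimum of the
rescaled product weights is at least the rescaled partition function at some exponent. -/
lemma eventually_exists_le_sum_inf' [Nonempty K] {q : K → J → ℝ} (hq0 : ∀ k y, 0 ≤ q k y)
    (hq : ∃ y, ∀ k, q k y ≠ 0) {ε : ℝ} (hε : 0 < ε) :
    ∀ᶠ n : ℕ in Filter.atTop, ∀ ξ : K → ℝ, ∃ α ∈ stdSimplex ℝ K,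
      Real.exp (-(n * ε)) * (partitionFn q α * Real.exp (-∑ k, α k * ξ k)) ^ n ≤
        2 * ∑ g : Fin n → J, Finset.univ.inf' Finset.univ_nonempty
          (fun k => kpow (q k) n g * Real.exp (-(n * ξ k))) := by
  obtain ⟨B, hB⟩ := exists_forall_abs_log_le q
  filter_upwards [eventually_le_sum_kpow_filter (I := J) K (4 * B) hε one_half_pos] with n hn
  intro ξ
  set s : Finset J := Finset.univ.filter fun y => ∀ k, q k y ≠ 0 with hs
  set ℓ : K → J → ℝ := fun k y => Real.log (q k y) - ξ k with hℓ
  obtain ⟨α, hα, hopt⟩ := exists_stdSimplex_tilt_nonneg s ℓ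
  refine ⟨α, hα, ?_⟩
  set A : J → ℝ := fun y => ∑ l, α l * ℓ l y with hA
  set W := ∑ y ∈ s, Real.exp (A y) with hW
  have hAe : ∀ y, A y = ∑ k, α k * Real.log (q k y) - ∑ k, α k * ξ k := fun y => by
    simp only [hA, hℓ, mul_sub, Finset.sum_sub_distrib]
  have hWe : partitionFn q α * Real.exp (-∑ k, α k * ξ k) = W := by
    rw [hW, partitionFn, Finset.sum_mul]
    refine Finset.sum_congr rfl fun y _ => ?_
    rw [← Real.exp_add, hAe, sub_eq_add_neg]
  have hW0 : 0 < W := by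
    rw [← hWe]; exact mul_pos (partitionFn_pos hq α) (Real.exp_pos _)
  set w : J → ℝ := fun y => if y ∈ s then Real.exp (A y) / W else 0 with hw
  have hw0 : ∀ y, 0 ≤ w y := fun y => by
    simp only [hw]; split_ifs; exacts [(div_pos (Real.exp_pos _) hW0).le, le_rfl]
  have hwsum : ∀ X : J → ℝ, ∑ y, w y * X y = (∑ y ∈ s, Real.exp (A y) * X y) / W := by
    intro X
    simp only [hw, ite_mul, zero_mul, Finset.sum_ite_mem, Finset.univ_inter, Finset.sum_div]
    exact Finset.sum_congr rfl fun y _ => by ring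
  have hw1 : ∑ y, w y = 1 := by
    have := hwsum fun _ => 1
    simpa [← hW, hW0.ne'] using this
  set e : K → ℝ := fun k => ∑ y, w y * (ℓ k y - A y) with he
  have he0 : ∀ k, 0 ≤ e k := fun k => by
    simp only [he]
    rw [hwsum fun y => ℓ k y - A y]
    exact div_nonneg (hopt k) hW0.le
  have hb : ∀ k y, |Real.log (q k y) - ∑ l, α l * Real.log (q l y)| ≤ 2 * B := fun k y => by
    have h1 := hB k y
    have h2 : |∑ l, α l * Real.log (q l y)| ≤ B := abs_sum_mul_le hα.1 hα.2 fun l => hB l y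
    calc _ ≤ |Real.log (q k y)| + |∑ l, α l * Real.log (q l y)| := abs_sub _ _
      _ ≤ 2 * B := by linarith
  have hdev : ∀ k y, ℓ k y - A y - e k = (Real.log (q k y) - ∑ l, α l * Real.log (q l y)) -
      ∑ y', w y' * (Real.log (q k y') - ∑ l, α l * Real.log (q l y')) := by
    intro k y
    have h1 : ∀ y, ℓ k y - A y = (Real.log (q k y) - ∑ l, α l * Real.log (q l y))
        - (ξ k - ∑ l, α l * ξ l) := fun y => by rw [hAe]; simp only [hℓ]; ring
    have h2 : e k = ∑ y', w y' * (Real.log (q k y') - ∑ l, α l * Real.log (q l y'))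
        - (ξ k - ∑ l, α l * ξ l) := by
      simp only [he, h1, mul_sub _ (Real.log _ - _), Finset.sum_sub_distrib]
      rw [← Finset.sum_mul, hw1, one_mul]
    rw [h1, h2]; ring
  have hgood := hn w (fun k y => ℓ k y - A y - e k) ⟨hw0, hw1⟩
    (fun k => by
      simp only [mul_sub _ (ℓ _ _ - _), Finset.sum_sub_distrib]
      rw [← Finset.sum_mul, hw1, one_mul, sub_self])
    (fun k y => by
      rw [hdev]
      have h1 := hb k y
      have h2 := abs_sum_mul_le hw0 hw1 (fun y => hb k y)
      calc _ ≤ _ + _ := abs_sub _ _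
        _ ≤ 4 * B := by linarith)
  have hterm : ∀ g : Fin n → J, (∀ k, |∑ j, (ℓ k (g j) - A (g j) - e k)| < n * ε) →
      Real.exp (-(n * ε)) * W ^ n * kpow w n g ≤ Finset.univ.inf' Finset.univ_nonempty
          (fun k => kpow (q k) n g * Real.exp (-(n * ξ k))) := by
    intro g hg
    refine Finset.le_inf' _ _ fun k _ => ?_
    by_cases hgs : ∀ j, g j ∈ s
    · have h1 : kpow (q k) n g * Real.exp (-(n * ξ k)) = Real.exp (∑ j, ℓ k (g j)) := by
        have : ∑ j, ℓ k (g j) = ∑ j, Real.log (q k (g j)) + -(n * ξ k) := by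
          simp only [hℓ, Finset.sum_sub_distrib, Finset.sum_const, Finset.card_univ,
            Fintype.card_fin, nsmul_eq_mul]
          ring
        rw [this, Real.exp_add, Real.exp_sum, kpow]
        congr 1
        refine Finset.prod_congr rfl fun j _ => (Real.exp_log ?_).symm
        exact lt_of_le_of_ne (hq0 _ _) ((Finset.mem_filter.1 (hgs j)).2 k).symm
      have h2 : W ^ n * kpow w n g = Real.exp (∑ j, A (g j)) := by
        rw [Real.exp_sum, kpow, ← Fin.prod_const, ← Finset.prod_mul_distrib]
        refine Finset.prod_congr rfl fun j _ => ?_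
        simp only [hw, hgs j, if_true]
        field_simp
      rw [h1, mul_assoc, h2, ← Real.exp_add, Real.exp_le_exp]
      have h3 := (abs_lt.1 (hg k)).1
      simp only [Finset.sum_sub_distrib, Finset.sum_const, Finset.card_univ, Fintype.card_fin,
        nsmul_eq_mul] at h3
      nlinarith [mul_nonneg (Nat.cast_nonneg (α := ℝ) n) (he0 k)]
    · have h0 : kpow w n g = 0 := by
        by_contra h
        refine hgs fun j => ?_
        by_contra hj
        exact kpow_ne_zero_iff.1 h j (by simp [hw, hj])
      rw [h0, mul_zero]
      exact mul_nonneg (kpow_nonneg (hq0 k) n g) (Real.exp_pos _).le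
  rw [hWe]
  have hnn : ∀ g : Fin n → J, 0 ≤ Finset.univ.inf' Finset.univ_nonempty
      (fun k => kpow (q k) n g * Real.exp (-(n * ξ k))) := fun g =>
    Finset.le_inf' _ _ fun k _ => mul_nonneg (kpow_nonneg (hq0 k) n g) (Real.exp_pos _).le
  have hfin : Real.exp (-(n * ε)) * W ^ n *
      ∑ g with ∀ k, |∑ j, (ℓ k (g j) - A (g j) - e k)| < n * ε, kpow w n g ≤
        ∑ g : Fin n → J, Finset.univ.inf' Finset.univ_nonempty
          (fun k => kpow (q k) n g * Real.exp (-(n * ξ k))) := by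
    rw [Finset.mul_sum]
    exact (Finset.sum_le_sum fun g hg => hterm g (Finset.mem_filter.1 hg).2).trans
      (Finset.sum_le_sum_of_subset_of_nonneg (Finset.filter_subset _ _) fun g _ _ => hnn g)
  have hpos : 0 < Real.exp (-(n * ε)) * W ^ n := mul_pos (Real.exp_pos _) (pow_pos hW0 n)
  nlinarith

end Tilting

section Gap

variable {K I J : Type} [Fintype K] [Fintype I] [Fintype J]

lemma exists_exp_le_of_forall_one_lt [Nonempty K] {g : (K → ℝ) → ℝ} (hg : Continuous g)
    (h : ∀ α ∈ stdSimplex ℝ K, 1 < g α) :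
    ∃ δ > 0, ∀ α ∈ stdSimplex ℝ K, Real.exp δ ≤ g α := by
  obtain ⟨α, hα, hmin⟩ := (isCompact_stdSimplex ℝ K).exists_isMinOn
    ⟨_, single_mem_stdSimplex ℝ (Classical.arbitrary K)⟩ hg.continuousOn
  refine ⟨Real.log (g α), Real.log_pos (h α hα), fun β hβ => ?_⟩
  rw [Real.exp_log (one_pos.trans (h α hα))]
  exact isMinOn_iff.1 hmin β hβ

lemma le_exp_neg_mul {a b δ : ℝ} (ha : 0 < a) (h : Real.exp δ ≤ b / a) :
    a ≤ Real.exp (-δ) * b := by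
  rw [le_div_iff₀ ha] at h
  rw [Real.exp_neg, inv_mul_eq_div, le_div_iff₀ (Real.exp_pos δ)]
  linarith

lemma exists_partitionFn_gap [Nonempty K] {p : K → I → ℝ} {q : K → J → ℝ}
    (hp : ∃ x, ∀ k, p k x ≠ 0)
    (h : ∀ α ∈ stdSimplex ℝ K, partitionFn p α < partitionFn q α) :
    ∃ δ > 0, ∀ α ∈ stdSimplex ℝ K, partitionFn p α ≤ Real.exp (-δ) * partitionFn q α := by
  obtain ⟨δ, hδ, H⟩ := exists_exp_le_of_forall_one_lt (K := K)
    (g := fun α => partitionFn q α / partitionFn p α)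
    ((continuous_partitionFn q).div (continuous_partitionFn p)
      fun α => (partitionFn_pos hp α).ne')
    (fun α hα => (one_lt_div (partitionFn_pos hp α)).2 (h α hα))
  exact ⟨δ, hδ, fun α hα => le_exp_neg_mul (partitionFn_pos hp α) (H α hα)⟩

/-- The two-column gap: the comparison of partition functions may degenerate at the vertex `a`,
where the relative entropy takes over. -/
lemma exists_partitionFn_gap_pair {p : K → I → ℝ} {q : K → J → ℝ} {a o : K} {τ : ℝ}
    (hao : a ≠ o) (hK : ∀ k, k = a ∨ k = o)
    (hp0 : ∀ k x, 0 ≤ p k x) (hp : ∃ x, ∀ k, p k x ≠ 0)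
    (h : ∀ α ∈ stdSimplex ℝ K, α a ≠ 1 → partitionFn p α < partitionFn q α)
    (ha : partitionFn p (Pi.single a 1) ≤ partitionFn q (Pi.single a 1))
    (hτ : ∑ x with ∀ k, p k x ≠ 0,
      p a x * (τ - (Real.log (p a x) - Real.log (p o x))) < 0) :
    ∃ δ > 0, ∀ ξ : K → ℝ, ξ o = 0 → ξ a ≤ τ → ∀ α ∈ stdSimplex ℝ K, ∃ β ∈ stdSimplex ℝ K,
      partitionFn p β * Real.exp (-∑ k, β k * ξ k) ≤
        Real.exp (-δ) * (partitionFn q α * Real.exp (-∑ k, α k * ξ k)) := by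
  have : Nonempty K := ⟨a⟩
  have huniv : (Finset.univ : Finset K) = {a, o} := by
    ext k; simpa using hK k
  have hsum : ∀ X : K → ℝ, ∑ k, X k = X a + X o := fun X => by
    rw [huniv, Finset.sum_pair hao]
  set b : ℝ → K → ℝ := fun η => (1 - η) • Pi.single a 1 + η • Pi.single o 1 with hb
  have hba : ∀ η, b η a = 1 - η := fun η => by simp [hb, hao]
  have hbo : ∀ η, b η o = η := fun η => by simp [hb, hao.symm]
  have hder : HasDerivAt (fun η => partitionFn p (b η) * Real.exp (η * τ))
      (∑ x with ∀ k, p k x ≠ 0,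
        p a x * (τ - (Real.log (p a x) - Real.log (p o x)))) 0 := by
    have e : (fun η => partitionFn p (b η) * Real.exp (η * τ)) = fun η =>
        ∑ x with ∀ k, p k x ≠ 0,
          Real.exp (Real.log (p a x) + η * (τ - (Real.log (p a x) - Real.log (p o x)))) := by
      funext η
      rw [partitionFn, Finset.sum_mul]
      refine Finset.sum_congr rfl fun x _ => ?_
      rw [← Real.exp_add, hsum, hba, hbo]
      ring_nf
    rw [e]
    refine HasDerivAt.fun_sum fun x hx => ?_
    have h1 : HasDerivAt (fun η : ℝ =>
        Real.log (p a x) + η * (τ - (Real.log (p a x) - Real.log (p o x))))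
        (1 * (τ - (Real.log (p a x) - Real.log (p o x)))) 0 :=
      ((hasDerivAt_id 0).mul_const _).const_add _
    have h2 := h1.exp
    rwa [zero_mul, add_zero, one_mul, Real.exp_log] at h2
    exact lt_of_le_of_ne (hp0 _ _) ((Finset.mem_filter.1 hx).2 a).symm
  obtain ⟨η, hη0, hη1, hlt⟩ := hder.exists_lt_of_neg hτ one_pos
  rw [zero_add] at hη1
  have hb0 : b 0 = Pi.single a 1 := by simp [hb]
  rw [hb0, zero_mul, Real.exp_zero, mul_one] at hlt
  have hbs : b η ∈ stdSimplex ℝ K :=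
    convex_stdSimplex ℝ K (single_mem_stdSimplex ℝ a) (single_mem_stdSimplex ℝ o)
      (by linarith) hη0.le (by ring)
  obtain ⟨δ, hδ, H⟩ := exists_exp_le_of_forall_one_lt (K := K)
    (g := fun α => max (partitionFn q α / partitionFn p α)
      (min (partitionFn q α * Real.exp ((1 - η - α a) * τ) / partitionFn p (b η))
        (1 + (α a - (1 - η)))))
    (by
      have h1 := continuous_partitionFn q
      have h2 := continuous_partitionFn p
      refine (h1.div h2 fun α => (partitionFn_pos hp α).ne').max (Continuous.min ?_ ?_)
      · exact (h1.mul (by fun_prop)).div_const _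
      · fun_prop)
    (fun α hα => by
      by_cases h1 : α a = 1
      · have hαo : α o = 0 := by
          have := hα.2
          rw [hsum] at this
          linarith
        have e : α = Pi.single a 1 := by
          funext k
          rcases hK k with rfl | rfl
          · simp [h1]
          · simp [hαo, hao.symm]
        refine lt_max_of_lt_right (lt_min ?_ (by linarith))
        rw [one_lt_div (partitionFn_pos hp _), h1, e]
        calc partitionFn p (b η) = partitionFn p (b η) * Real.exp (η * τ) *
              Real.exp ((1 - η - 1) * τ) := by
              rw [mul_assoc, ← Real.exp_add]; ring_nf; simp
          _ < _ := mul_lt_mul_of_pos_right (hlt.trans_le ha) (Real.exp_pos _)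
      · exact lt_max_of_lt_left ((one_lt_div (partitionFn_pos hp α)).2 (h α hα h1)))
  refine ⟨δ, hδ, fun ξ hξo hξa α hα => ?_⟩
  rcases le_max_iff.1 (H α hα) with h1 | h1
  · refine ⟨α, hα, ?_⟩
    rw [← mul_assoc]
    exact mul_le_mul_of_nonneg_right (le_exp_neg_mul (partitionFn_pos hp α) h1) (Real.exp_pos _).le
  · obtain ⟨h2, h3⟩ := le_min_iff.1 h1
    have h4 : 1 - η ≤ α a := by linarith [Real.add_one_le_exp δ]
    refine ⟨b η, hbs, ?_⟩
    have h5 := le_exp_neg_mul (partitionFn_pos hp _) h2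
    rw [hsum, hsum, hba, hbo, hξo, mul_zero, add_zero, mul_zero, add_zero]
    have h6 : Real.exp ((1 - η - α a) * τ) ≤ Real.exp ((1 - η - α a) * ξ a) :=
      Real.exp_le_exp.2 (mul_le_mul_of_nonpos_left hξa (by linarith))
    have h7 : 0 ≤ Real.exp (-δ) * partitionFn q α := by
      have : 0 ≤ partitionFn q α := Finset.sum_nonneg fun _ _ => (Real.exp_pos _).le
      exact mul_nonneg (Real.exp_pos _).le this
    calc partitionFn p (b η) * Real.exp (-((1 - η) * ξ a))
        ≤ Real.exp (-δ) * partitionFn q α * Real.exp ((1 - η - α a) * ξ a) *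
            Real.exp (-((1 - η) * ξ a)) := by
          refine mul_le_mul_of_nonneg_right (h5.trans ?_) (Real.exp_pos _).le
          rw [← mul_assoc]
          exact mul_le_mul_of_nonneg_left h6 h7
      _ = _ := by
          rw [mul_assoc, ← Real.exp_add, mul_assoc]
          ring_nf

lemma sum_filter_kpow_le {p : K → I → ℝ} (hp0 : ∀ k x, 0 ≤ p k x) {o : K} {n : ℕ} {ξ : K → ℝ}
    {β : K → ℝ} (hβ : ∑ k, β k = 1) (s : Finset (Fin n → I))
    (hs : ∀ f ∈ s, kpow (p o) n f ≠ 0 ∧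
      ∀ k, kpow (p k) n f = Real.exp (n * ξ k) * kpow (p o) n f) :
    ∑ f ∈ s, kpow (p o) n f ≤ (partitionFn p β * Real.exp (-∑ k, β k * ξ k)) ^ n := by
  set u : I → ℝ := fun x => if ∀ k, p k x ≠ 0 then
    Real.exp (∑ k, β k * Real.log (p k x)) * Real.exp (-∑ k, β k * ξ k) else 0 with hu
  have hu0 : ∀ x, 0 ≤ u x := fun x => by
    simp only [hu]; split_ifs <;> positivity
  have hsum : ∑ x, u x = partitionFn p β * Real.exp (-∑ k, β k * ξ k) := by
    rw [partitionFn, Finset.sum_mul, Finset.sum_filter]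
  rw [← hsum, ← sum_kpow]
  refine (Finset.sum_le_sum (g := kpow u n) fun f hf => ?_).trans
    (Finset.sum_le_sum_of_subset_of_nonneg (Finset.subset_univ s) fun f _ _ => kpow_nonneg hu0 n f)
  obtain ⟨h0, hk⟩ := hs f hf
  have hne : ∀ j k, p k (f j) ≠ 0 := fun j k =>
    kpow_ne_zero_iff.1 (by rw [hk]; exact mul_ne_zero (Real.exp_pos _).ne' h0) j
  have hpos : 0 < kpow (p o) n f := lt_of_le_of_ne (kpow_nonneg (hp0 o) n f) h0.symm
  have hlog : ∀ k, ∑ j, Real.log (p k (f j)) = n * ξ k + Real.log (kpow (p o) n f) := fun k => by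
    rw [← Real.log_prod (fun j _ => hne j k), ← Real.log_exp (n * ξ k),
      ← Real.log_mul (Real.exp_pos _).ne' h0, ← hk]
    rfl
  have e : kpow u n f = Real.exp (∑ j : Fin n, (∑ k, β k * Real.log (p k (f j)) -
      ∑ k, β k * ξ k)) := by
    rw [Real.exp_sum, kpow]
    refine Finset.prod_congr rfl fun j _ => ?_
    simp only [hu, hne j, ne_eq, not_false_eq_true, implies_true, if_true]
    rw [← Real.exp_add, sub_eq_add_neg]
  rw [e, Finset.sum_sub_distrib, Finset.sum_comm]
  simp only [← Finset.mul_sum, hlog, Finset.sum_const, Finset.card_univ, Fintype.card_fin,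
    nsmul_eq_mul, mul_add, Finset.sum_add_distrib, ← Finset.sum_mul, hβ, one_mul]
  have : ∑ k, β k * (n * ξ k) = n * ∑ k, β k * ξ k := by
    rw [Finset.mul_sum]; exact Finset.sum_congr rfl fun k _ => by ring
  rw [this, add_sub_cancel_left, Real.exp_log hpos]

/-- A gap of partition functions yields an exponential gap between the mass of a single ratio
class of `p^{⊗n}` and the overlap of the rescaled columns of `q^{⊗n}`. -/
lemma eventually_sum_filter_le_sum_inf' [Nonempty K] {p : K → I → ℝ} {q : K → J → ℝ}
    (hp0 : ∀ k x, 0 ≤ p k x) (hq0 : ∀ k y, 0 ≤ q k y)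
    (hq : ∃ y, ∀ k, q k y ≠ 0) {o : K} (Ξ : Set (K → ℝ)) {δ : ℝ} (hδ : 0 < δ)
    (hgap : ∀ ξ ∈ Ξ, ∀ α ∈ stdSimplex ℝ K, ∃ β ∈ stdSimplex ℝ K,
      partitionFn p β * Real.exp (-∑ k, β k * ξ k) ≤
        Real.exp (-δ) * (partitionFn q α * Real.exp (-∑ k, α k * ξ k))) (C : ℝ) (D : ℕ) :
    ∀ᶠ n : ℕ in Filter.atTop, ∀ ξ ∈ Ξ, ∀ s : Finset (Fin n → I),
      (∀ f ∈ s, kpow (p o) n f ≠ 0 ∧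
        ∀ k, kpow (p k) n f = Real.exp (n * ξ k) * kpow (p o) n f) →
      C * (n + 1) ^ D * ∑ f ∈ s, kpow (p o) n f ≤
        ∑ g : Fin n → J, Finset.univ.inf' Finset.univ_nonempty
          (fun k => kpow (q k) n g * Real.exp (-(n * ξ k))) := by
  filter_upwards [eventually_exists_le_sum_inf' hq0 hq (half_pos hδ),
    eventually_mul_pow_le_exp (2 * C) D (half_pos hδ)] with n h1 h2 ξ hξ s hs
  obtain ⟨α, hα, hle⟩ := h1 ξ
  obtain ⟨β, hβ, hpq⟩ := hgap ξ hξ α hα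
  have h3 := sum_filter_kpow_le hp0 hβ.2 s hs
  have hpf : 0 ≤ partitionFn p β := Finset.sum_nonneg fun _ _ => (Real.exp_pos _).le
  have h4 : ∑ f ∈ s, kpow (p o) n f ≤ Real.exp (-(n * δ)) *
      (partitionFn q α * Real.exp (-∑ k, α k * ξ k)) ^ n := by
    refine h3.trans ((pow_le_pow_left₀ (mul_nonneg hpf (Real.exp_pos _).le) hpq n).trans ?_)
    rw [mul_pow, ← Real.exp_nat_mul, mul_neg]
  have hs0 : 0 ≤ ∑ f ∈ s, kpow (p o) n f := Finset.sum_nonneg fun f _ => kpow_nonneg (hp0 o) n f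
  have h5 : 2 * C * (n + 1) ^ D * ∑ f ∈ s, kpow (p o) n f ≤ Real.exp (-(n * (δ / 2))) *
      (partitionFn q α * Real.exp (-∑ k, α k * ξ k)) ^ n := by
    calc _ ≤ Real.exp (n * (δ / 2)) * ∑ f ∈ s, kpow (p o) n f :=
          mul_le_mul_of_nonneg_right h2 hs0
      _ ≤ Real.exp (n * (δ / 2)) * _ := mul_le_mul_of_nonneg_left h4 (Real.exp_pos _).le
      _ = _ := by
        rw [← mul_assoc, ← Real.exp_add]; ring_nf
  linarith

end Gap

section Columns

variable {I J : Type} [Fintype I] [Fintype J] {d : ℕ}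

/-- `Φ_{α,C}` as a partition function of the columns in `C`. -/
lemma phiAC_eq_partitionFn {p : Fin d → I → ℝ} (hp : ∀ k x, 0 ≤ p k x) (C : Finset (Fin d))
    (α : C → ℝ) :
    phiAC d (fun k => if h : k ∈ C then α ⟨k, h⟩ else 0) C p =
      partitionFn (fun k : C => p k) α := by
  unfold phiAC partitionFn
  refine Finset.sum_congr (by ext x; simp) fun x hx => ?_
  rw [Real.exp_sum, ← Finset.prod_subset (Finset.subset_univ C), ← Finset.prod_coe_sort C]
  · refine Finset.prod_congr rfl fun k _ => ?_
    have hk : p k x ≠ 0 := (Finset.mem_filter.1 hx).2 k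
    simp only
    rw [dif_pos k.2, Real.rpow_def_of_pos (lt_of_le_of_ne (hp _ _) hk.symm), mul_comm]
  · intro k _ hk
    simp only
    rw [dif_neg hk, Real.rpow_zero]

lemma exists_extend_stdSimplex {C : Finset (Fin d)} {α : C → ℝ} (hα : α ∈ stdSimplex ℝ C) :
    (∀ k, 0 ≤ (fun k => if h : k ∈ C then α ⟨k, h⟩ else 0 : Fin d → ℝ) k) ∧
    (∑ k, (fun k => if h : k ∈ C then α ⟨k, h⟩ else 0 : Fin d → ℝ) k) = 1 ∧
    ∀ k, 0 < (fun k => if h : k ∈ C then α ⟨k, h⟩ else 0 : Fin d → ℝ) k → k ∈ C := by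
  refine ⟨fun k => ?_, ?_, fun k hk => ?_⟩
  · dsimp only
    split_ifs
    exacts [hα.1 _, le_rfl]
  · rw [← Finset.sum_subset (Finset.subset_univ C), ← Finset.sum_coe_sort C, ← hα.2]
    · exact Finset.sum_congr rfl fun k _ => by simp
    · intro k _ hk
      simp [hk]
  · by_contra h
    simp [h] at hk

/-- The strict comparison of all nondegenerate `Φ_{α,C}`. -/
def PhiLT (p : Fin (d + 1) → I → ℝ) (q : Fin (d + 1) → J → ℝ) : Prop :=
  ∀ (α : Fin (d + 1) → ℝ) (C : Finset (Fin (d + 1))),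
    (∀ k, 0 ≤ α k) → (∑ k, α k = 1) → (∀ k, 0 < α k → k ∈ C) →
    ¬ (∃ k, α = stdBasis (d + 1) k ∧ C ⊆ {k, Fin.last d}) →
    phiAC (d + 1) α C p < phiAC (d + 1) α C q

lemma PhiLT.partitionFn_lt {p : Fin (d + 1) → I → ℝ} {q : Fin (d + 1) → J → ℝ} (h : PhiLT p q)
    (hp : ∀ k x, 0 ≤ p k x) (hq : ∀ k x, 0 ≤ q k x) {C : Finset (Fin (d + 1))} {α : C → ℝ}
    (hα : α ∈ stdSimplex ℝ C) (hC : ∀ k : C, α k = 1 → ¬ C ⊆ {k.1, Fin.last d}) :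
    partitionFn (fun k : C => p k) α < partitionFn (fun k : C => q k) α := by
  rw [← phiAC_eq_partitionFn hp, ← phiAC_eq_partitionFn hq]
  obtain ⟨h0, h1, h2⟩ := exists_extend_stdSimplex hα
  refine h _ _ h0 h1 h2 ?_
  rintro ⟨k, hk, hCk⟩
  have h3 := congrFun hk k
  simp only [stdBasis, if_true] at h3
  by_cases hkC : k ∈ C
  · rw [dif_pos hkC] at h3
    exact hC ⟨k, hkC⟩ h3 hCk
  · simp [dif_neg hkC] at h3

lemma partitionFn_single {K : Type} [Fintype K] {p : K → I → ℝ} (hp : ∀ k x, 0 ≤ p k x) {a : K}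
    (ha : ∀ x, p a x ≠ 0 → ∀ k, p k x ≠ 0) : partitionFn p (Pi.single a 1) = ∑ x, p a x := by
  unfold partitionFn
  rw [Finset.sum_filter]
  refine Finset.sum_congr rfl fun x _ => ?_
  split_ifs with h
  · have : ∑ k, (Pi.single a 1 : K → ℝ) k * Real.log (p k x) = Real.log (p a x) := by
      simp [Pi.single_apply]
    rw [this, Real.exp_log (lt_of_le_of_ne (hp _ _) (h a).symm)]
  · by_contra hne
    exact h (ha x (Ne.symm hne))

/-- The columns in `S` together with the dominating column. -/
def withLast (S : Finset (Fin d)) : Finset (Fin (d + 1)) :=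
  insert (Fin.last d) (S.map Fin.castSuccEmb)

lemma last_mem_withLast (S : Finset (Fin d)) : Fin.last d ∈ withLast S :=
  Finset.mem_insert_self _ _

lemma castSucc_mem_withLast {S : Finset (Fin d)} {k : Fin d} : k.castSucc ∈ withLast S ↔ k ∈ S := by
  simp [withLast, Fin.castSucc_ne_last]

lemma exists_gap_withLast {p : Fin (d + 1) → I → ℝ} {q : Fin (d + 1) → J → ℝ}
    (hp : ∀ k, IsProb (p k)) (hq : ∀ k, IsProb (q k))
    (hpsup : ∃ x, ∀ k, p k x ≠ 0)
    (hpdom : ∀ (k : Fin d) x, p k.castSucc x ≠ 0 → p (Fin.last d) x ≠ 0)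
    (hqdom : ∀ (k : Fin d) y, q k.castSucc y ≠ 0 → q (Fin.last d) y ≠ 0)
    (h : PhiLT p q) {τ : Fin d → ℝ} (hτ : ∀ k : Fin d, τ k < D1 (p k.castSucc) (p (Fin.last d)))
    {S : Finset (Fin d)} (hS : S.Nonempty) :
    ∃ δ > 0, ∀ ξ : withLast S → ℝ, ξ ⟨_, last_mem_withLast S⟩ = 0 →
      (∀ k, ∀ hk : k ∈ S, S = {k} → ξ ⟨k.castSucc, castSucc_mem_withLast.2 hk⟩ ≤ τ k) →
      ∀ α ∈ stdSimplex ℝ (withLast S), ∃ β ∈ stdSimplex ℝ (withLast S),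
      partitionFn (fun k : withLast S => p k) β * Real.exp (-∑ k, β k * ξ k) ≤
        Real.exp (-δ) *
          (partitionFn (fun k : withLast S => q k) α * Real.exp (-∑ k, α k * ξ k)) := by
  have hp0 : ∀ k x, 0 ≤ p k x := fun k => (hp k).1
  have hq0 : ∀ k x, 0 ≤ q k x := fun k => (hq k).1
  have hsup : ∃ x, ∀ k : withLast S, p k x ≠ 0 := hpsup.imp fun x hx k => hx k
  have : Nonempty (withLast S) := ⟨⟨_, last_mem_withLast S⟩⟩
  rcases hS.exists_eq_singleton_or_nontrivial with ⟨k, rfl⟩ | hnt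
  · set o : withLast {k} := ⟨_, last_mem_withLast {k}⟩ with ho
    set a : withLast {k} := ⟨k.castSucc, castSucc_mem_withLast.2 (Finset.mem_singleton_self k)⟩
      with ha
    have hao : a ≠ o := fun h => (Fin.castSucc_ne_last k) (congrArg Subtype.val h)
    have hK : ∀ l : withLast {k}, l = a ∨ l = o := by
      rintro ⟨l, hl⟩
      simp only [withLast, Finset.map_singleton, Finset.mem_insert, Finset.mem_singleton] at hl
      rcases hl with rfl | rfl
      exacts [Or.inr rfl, Or.inl rfl]
    have hap : ∀ x, p a x ≠ 0 → ∀ l : withLast {k}, p l x ≠ 0 := fun x hx l => by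
      rcases hK l with rfl | rfl
      exacts [hx, hpdom k x hx]
    have haq : ∀ x, q a x ≠ 0 → ∀ l : withLast {k}, q l x ≠ 0 := fun x hx l => by
      rcases hK l with rfl | rfl
      exacts [hx, hqdom k x hx]
    obtain ⟨δ, hδ, H⟩ := exists_partitionFn_gap_pair (p := fun l : withLast {k} => p l)
      (q := fun l : withLast {k} => q l) (τ := τ k) hao hK (fun l => hp0 l) hsup
      (fun α hα hα1 => by
        refine h.partitionFn_lt hp0 hq0 hα fun l hl hsub => ?_
        rcases hK l with rfl | rfl
        · exact hα1 hl
        · have := hsub a.2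
          simp [ha, ho, Fin.castSucc_ne_last] at this)
      (by
        rw [partitionFn_single (p := fun l : withLast {k} => p l) (fun l => hp0 l) hap,
          partitionFn_single (p := fun l : withLast {k} => q l) (fun l => hq0 l) haq]
        exact ((hp _).2.trans (hq _).2.symm).le)
      (by
        have e : ∑ x with ∀ l : withLast {k}, p l x ≠ 0,
            p a x * (τ k - (Real.log (p a x) - Real.log (p o x))) =
            τ k * ∑ x, p a x - D1 (p k.castSucc) (p (Fin.last d)) := by
          rw [D1, Finset.mul_sum, Finset.sum_filter, Finset.sum_filter, ← Finset.sum_sub_distrib]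
          refine Finset.sum_congr rfl fun x _ => ?_
          by_cases hx : p a x = 0
          · have hx' : p k.castSucc x = 0 := hx
            simp [hx, hx']
          · rw [if_pos (hap x hx), if_pos hx, Real.log_div hx (hap x hx o)]
            ring
        rw [e, (hp _).2, mul_one]
        linarith [hτ k])
    exact ⟨δ, hδ, fun ξ hξo hξk α hα =>
      H ξ hξo (hξk k (Finset.mem_singleton_self k) rfl) α hα⟩
  · obtain ⟨δ, hδ, H⟩ := exists_partitionFn_gap (p := fun l : withLast S => p l)
      (q := fun l : withLast S => q l) hsup
      (fun α hα => by
        refine h.partitionFn_lt hp0 hq0 hα fun l _ hsub => ?_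
        obtain ⟨k₁, h₁, k₂, h₂, hne⟩ := hnt
        have m₁ := hsub (castSucc_mem_withLast.2 h₁)
        have m₂ := hsub (castSucc_mem_withLast.2 h₂)
        simp only [Finset.mem_insert, Finset.mem_singleton, Fin.castSucc_ne_last, or_false]
          at m₁ m₂
        exact hne (Fin.castSucc_injective d (m₁.trans m₂.symm)))
    refine ⟨δ, hδ, fun ξ _ _ α hα => ⟨α, hα, ?_⟩⟩
    rw [← mul_assoc]
    exact mul_le_mul_of_nonneg_right (H α hα) (Real.exp_pos _).le

/-- Ratio classes of `p^{⊗n}` that are not far out on an axis are dominated by suitable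
sub-vectors of `q^{⊗n}`. -/
lemma eventually_exists_dominating {p : Fin (d + 1) → I → ℝ} {q : Fin (d + 1) → J → ℝ}
    (hp : ∀ k, IsProb (p k)) (hq : ∀ k, IsProb (q k))
    (hpsup : ∃ x, ∀ k, p k x ≠ 0) (hqsup : ∃ y, ∀ k, q k y ≠ 0)
    (hpdom : ∀ (k : Fin d) x, p k.castSucc x ≠ 0 → p (Fin.last d) x ≠ 0)
    (hqdom : ∀ (k : Fin d) y, q k.castSucc y ≠ 0 → q (Fin.last d) y ≠ 0)
    (h : PhiLT p q) {τ : Fin d → ℝ} (hτ : ∀ k : Fin d, τ k < D1 (p k.castSucc) (p (Fin.last d)))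
    (C : ℝ) (D : ℕ) :
    ∀ᶠ n : ℕ in Filter.atTop, ∀ f₀ : Fin n → I, kpow (p (Fin.last d)) n f₀ ≠ 0 →
      (∃ k : Fin d, kpow (p k.castSucc) n f₀ ≠ 0) →
      (∀ k : Fin d, (∀ l : Fin d, l ≠ k → kpow (p l.castSucc) n f₀ = 0) →
        kpow (p k.castSucc) n f₀ ≤ Real.exp (n * τ k) * kpow (p (Fin.last d)) n f₀) →
      ∃ c : (Fin n → J) → ℝ, (∀ g, 0 ≤ c g) ∧ (∀ g, c g ≤ kpow (q (Fin.last d)) n g) ∧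
        (∀ g (k : Fin d), c g * kpow (p k.castSucc) n f₀ ≤
          kpow (q k.castSucc) n g * kpow (p (Fin.last d)) n f₀) ∧
        C * (n + 1) ^ D * ∑ f with kpow (p (Fin.last d)) n f ≠ 0 ∧
          ∀ k : Fin d, kpow (p k.castSucc) n f * kpow (p (Fin.last d)) n f₀ =
            kpow (p k.castSucc) n f₀ * kpow (p (Fin.last d)) n f, kpow (p (Fin.last d)) n f
          ≤ ∑ g, c g := by
  have hp0 : ∀ k x, 0 ≤ p k x := fun k => (hp k).1
  have hq0 : ∀ k x, 0 ≤ q k x := fun k => (hq k).1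
  have key : ∀ᶠ n : ℕ in Filter.atTop, ∀ S : Finset (Fin d), S.Nonempty →
      ∀ ξ : withLast S → ℝ, ξ ⟨_, last_mem_withLast S⟩ = 0 →
      (∀ k, ∀ hk : k ∈ S, S = {k} → ξ ⟨k.castSucc, castSucc_mem_withLast.2 hk⟩ ≤ τ k) →
      ∀ s : Finset (Fin n → I), (∀ f ∈ s, kpow (p (Fin.last d)) n f ≠ 0 ∧
        ∀ k : withLast S,
          kpow (p k) n f = Real.exp (n * ξ k) * kpow (p (Fin.last d)) n f) →
      C * (n + 1) ^ D * ∑ f ∈ s, kpow (p (Fin.last d)) n f ≤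
        ∑ g : Fin n → J, Finset.univ.inf' ⟨⟨_, last_mem_withLast S⟩, Finset.mem_univ _⟩
          (fun k : withLast S => kpow (q k) n g * Real.exp (-(n * ξ k))) := by
    rw [Filter.eventually_all]
    intro S
    by_cases hS : S.Nonempty
    swap
    · exact Filter.Eventually.of_forall fun n h => absurd h hS
    obtain ⟨δ, hδ, H⟩ := exists_gap_withLast hp hq hpsup hpdom hqdom h hτ hS
    have : Nonempty (withLast S) := ⟨⟨_, last_mem_withLast S⟩⟩
    filter_upwards [eventually_sum_filter_le_sum_inf' (p := fun l : withLast S => p l)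
      (q := fun l : withLast S => q l) (o := ⟨_, last_mem_withLast S⟩) (fun l => hp0 l)
      (fun l => hq0 l) (hqsup.imp fun x hx k => hx k)
      {ξ | ξ ⟨_, last_mem_withLast S⟩ = 0 ∧ ∀ k, ∀ hk : k ∈ S, S = {k} →
        ξ ⟨k.castSucc, castSucc_mem_withLast.2 hk⟩ ≤ τ k} hδ
      (fun ξ hξ => H ξ hξ.1 hξ.2) C D] with n hn _ ξ h1 h2 s hs
    exact hn ξ ⟨h1, h2⟩ s hs
  filter_upwards [key, Filter.eventually_gt_atTop 0] with n hn hn0 f₀ hf₀ hex hax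
  have hn' : (0 : ℝ) < n := Nat.cast_pos.2 hn0
  set m := kpow (p (Fin.last d)) n f₀ with hm
  have hm0 : 0 < m := lt_of_le_of_ne (kpow_nonneg (hp0 _) n f₀) hf₀.symm
  set S : Finset (Fin d) := Finset.univ.filter fun k => kpow (p k.castSucc) n f₀ ≠ 0 with hS
  set ξ : withLast S → ℝ := fun k => Real.log (kpow (p k) n f₀ / m) / n with hξ
  have hpos : ∀ k : withLast S, 0 < kpow (p k) n f₀ := by
    rintro ⟨k, hk⟩
    refine lt_of_le_of_ne (kpow_nonneg (hp0 _) n f₀) ?_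
    induction k using Fin.lastCases with
    | last => exact hf₀.symm
    | cast k =>
      exact (Finset.mem_filter.1 (castSucc_mem_withLast.1 hk)).2.symm
  have hexp : ∀ k : withLast S, Real.exp (n * ξ k) = kpow (p k) n f₀ / m := fun k => by
    simp only [hξ]
    rw [mul_div_cancel₀ _ hn'.ne', Real.exp_log (div_pos (hpos k) hm0)]
  refine ⟨fun g => Finset.univ.inf' ⟨⟨_, last_mem_withLast S⟩, Finset.mem_univ _⟩
    (fun k : withLast S => kpow (q k) n g * Real.exp (-(n * ξ k))), fun g => ?_, fun g => ?_,
    fun g k => ?_, ?_⟩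
  · exact Finset.le_inf' _ _ fun k _ => mul_nonneg (kpow_nonneg (hq0 _) n g) (Real.exp_pos _).le
  · refine (Finset.inf'_le _ (Finset.mem_univ ⟨_, last_mem_withLast S⟩)).trans ?_
    rw [Real.exp_neg, hexp]
    simp [← hm, hm0.ne']
  · by_cases hk : k ∈ S
    · have h1 := Finset.inf'_le (fun k : withLast S => kpow (q k) n g * Real.exp (-(n * ξ k)))
        (Finset.mem_univ ⟨_, castSucc_mem_withLast.2 hk⟩)
      rw [Real.exp_neg, hexp, inv_div] at h1
      have h2 := hpos ⟨_, castSucc_mem_withLast.2 hk⟩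
      refine (mul_le_mul_of_nonneg_right h1 h2.le).trans (le_of_eq ?_)
      field_simp
    · have : kpow (p k.castSucc) n f₀ = 0 := by simpa [hS] using hk
      rw [this, mul_zero]
      exact mul_nonneg (kpow_nonneg (hq0 _) n g) hm0.le
  · refine hn S ?_ ξ ?_ ?_ _ ?_
    · obtain ⟨k, hk⟩ := hex
      exact ⟨k, by simpa [hS] using hk⟩
    · simp [hξ, ← hm, hm0.ne']
    · intro k hk hSk
      rw [← mul_le_mul_iff_right₀ hn', ← Real.exp_le_exp, hexp, div_le_iff₀ hm0]
      refine hax k fun l hl => ?_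
      by_contra hl'
      have : l ∈ S := by simpa [hS] using hl'
      rw [hSk] at this
      exact hl (Finset.mem_singleton.1 this)
    · intro f hf
      obtain ⟨h1, h2⟩ := (Finset.mem_filter.1 hf).2
      refine ⟨h1, fun k => ?_⟩
      rw [hexp]
      obtain ⟨k, hk⟩ := k
      induction k using Fin.lastCases with
      | last => simp [← hm, hm0.ne']
      | cast k =>
        have := h2 k
        field_simp
        linarith

end Columns

lemma kpow_mul_exp {I : Type} (u L : I → ℝ) (c : ℝ) (n : ℕ) (f : Fin n → I) :
    kpow (fun x => u x * Real.exp (c * L x)) n f = kpow u n f * Real.exp (c * ∑ j, L (f j)) := by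
  rw [Finset.mul_sum, Real.exp_sum]
  exact Finset.prod_mul_distrib

section Tails

variable {I J : Type} [Fintype I] [Fintype J]

/-- The moment generating function of `L` under the weights `u`. -/
def expMoment (u L : I → ℝ) (c : ℝ) : ℝ := ∑ x, u x * Real.exp (c * L x)

lemma continuous_expMoment (u L : I → ℝ) : Continuous (expMoment u L) := by
  unfold expMoment
  fun_prop

lemma expMoment_pos {u : I → ℝ} (hu : IsProb u) (L : I → ℝ) (c : ℝ) : 0 < expMoment u L c := by
  obtain ⟨x, -, hx⟩ := Finset.exists_ne_zero_of_sum_ne_zero (s := Finset.univ) (f := u)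
    (by rw [hu.2]; exact one_ne_zero)
  refine Finset.sum_pos' (fun y _ => mul_nonneg (hu.1 y) (Real.exp_pos _).le)
    ⟨x, Finset.mem_univ x, mul_pos (lt_of_le_of_ne (hu.1 x) hx.symm) (Real.exp_pos _)⟩

lemma expMoment_zero {u : I → ℝ} (hu : IsProb u) (L : I → ℝ) : expMoment u L 0 = 1 := by
  simp [expMoment, hu.2]

/-- Exponential tilts reach every mean below the essential maximum, with bounded parameter. -/
lemma exists_tilt_mean_ge {u L : I → ℝ} (hu : IsProb u) {a : I} {D : ℝ} (ha : 0 < u a)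
    (hD : D < L a) :
    ∃ c₁ > 0, ∀ τ ≤ D, ∃ c, 0 ≤ c ∧ c ≤ c₁ ∧
      0 ≤ ∑ x, u x * Real.exp (c * L x) * (L x - τ) ∧
      c * ∑ x, u x * Real.exp (c * L x) * (L x - τ) = 0 := by
  have hX : 0 < u a * (L a - D) := mul_pos ha (sub_pos.2 hD)
  set c₁ := 1 / (u a * (L a - D)) with hc₁
  have hc₁0 : 0 < c₁ := one_div_pos.2 hX
  refine ⟨c₁, hc₁0, fun τ hτ => ?_⟩
  set S : ℝ → ℝ := fun c => ∑ x, u x * Real.exp (c * L x) * (L x - τ) with hS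
  have hlow : ∀ y : ℝ, -1 ≤ y * Real.exp y := fun y => by
    have h1 := mul_le_mul_of_nonneg_right (Real.add_one_le_exp (-y)) (Real.exp_pos y).le
    rw [← Real.exp_add, neg_add_cancel, Real.exp_zero] at h1
    nlinarith [Real.exp_pos y]
  have hend : 0 ≤ S c₁ := by
    have h1 : ∀ x, u x * (if x = a then L a - D else 0) - u x * (1 / c₁) ≤
        u x * (Real.exp (c₁ * (L x - D)) * (L x - D)) := by
      intro x
      rw [← mul_sub]
      refine mul_le_mul_of_nonneg_left ?_ (hu.1 x)
      split_ifs with hx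
      · subst hx
        have h2 := Real.add_one_le_exp (c₁ * (L x - D))
        have h3 : 0 < L x - D := sub_pos.2 hD
        have h4 : 0 < c₁ * (L x - D) := mul_pos hc₁0 h3
        have h5 : 0 < 1 / c₁ := one_div_pos.2 hc₁0
        nlinarith
      · have h2 := hlow (c₁ * (L x - D))
        rw [zero_sub, ← mul_le_mul_iff_right₀ hc₁0]
        calc c₁ * -(1 / c₁) = -1 := by field_simp
          _ ≤ _ := h2
          _ = _ := by ring
    have h2 := Finset.sum_le_sum fun x (_ : x ∈ Finset.univ) => h1 x
    rw [Finset.sum_sub_distrib, ← Finset.sum_mul, hu.2] at h2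
    simp only [mul_ite, mul_zero, Finset.sum_ite_eq', Finset.mem_univ, if_true, hc₁,
      one_div_one_div, one_mul, sub_self] at h2
    rw [← hc₁] at h2
    have h3 : S c₁ = ∑ x, u x * Real.exp (c₁ * L x) * (L x - D) +
        (D - τ) * ∑ x, u x * Real.exp (c₁ * L x) := by
      simp only [hS]
      rw [Finset.mul_sum, ← Finset.sum_add_distrib]
      exact Finset.sum_congr rfl fun x _ => by ring
    have h4 : ∑ x, u x * Real.exp (c₁ * L x) * (L x - D) = Real.exp (c₁ * D) *
        ∑ x, u x * (Real.exp (c₁ * (L x - D)) * (L x - D)) := by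
      rw [Finset.mul_sum]
      refine Finset.sum_congr rfl fun x _ => ?_
      rw [show c₁ * L x = c₁ * D + c₁ * (L x - D) by ring, Real.exp_add]
      ring
    rw [h3, h4]
    have h5 := (expMoment_pos hu L c₁).le
    exact add_nonneg (mul_nonneg (Real.exp_pos _).le h2) (mul_nonneg (sub_nonneg.2 hτ) h5)
  by_cases h0 : 0 ≤ S 0
  · exact ⟨0, le_rfl, hc₁0.le, h0, zero_mul _⟩
  · have hcont : Continuous S := by fun_prop
    obtain ⟨c, hc, hc0⟩ := intermediate_value_Icc hc₁0.le hcont.continuousOn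
      ⟨(not_le.1 h0).le, hend⟩
    exact ⟨c, hc.1, hc.2, hc0.ge, by rw [show ∑ x, u x * Real.exp (c * L x) * (L x - τ) = 0
      from hc0, mul_zero]⟩

lemma sum_filter_kpow_ne_zero_le {θ w : I → ℝ} (hθ : IsProb θ) {a : I} (ha : w a = 0) (n : ℕ) :
    ∑ f with kpow w n f ≠ 0, kpow θ n f ≤ (1 - θ a) ^ n := by
  set θ' : I → ℝ := fun x => if w x ≠ 0 then θ x else 0 with hθ'
  have h0 : ∀ x, 0 ≤ θ' x := fun x => by
    simp only [hθ']; split_ifs; exacts [hθ.1 x, le_rfl]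
  have h1 : ∑ x, θ' x ≤ 1 - θ a := by
    have : ∑ x, (θ' x + if x = a then θ a else 0) ≤ ∑ x, θ x := by
      refine Finset.sum_le_sum fun x _ => ?_
      by_cases hx : x = a
      · subst hx; simp [hθ', ha]
      · simp only [hx, if_false, add_zero, hθ']
        split_ifs
        exacts [le_rfl, hθ.1 x]
    rw [Finset.sum_add_distrib, hθ.2] at this
    simp only [Finset.sum_ite_eq', Finset.mem_univ, if_true] at this
    linarith
  calc ∑ f with kpow w n f ≠ 0, kpow θ n f = ∑ f with kpow w n f ≠ 0, kpow θ' n f := by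
        refine Finset.sum_congr rfl fun f hf => Finset.prod_congr rfl fun j _ => ?_
        rw [hθ']
        exact (if_pos (kpow_ne_zero_iff.1 (Finset.mem_filter.1 hf).2 j)).symm
    _ ≤ ∑ f, kpow θ' n f := Finset.sum_le_sum_of_subset_of_nonneg (Finset.filter_subset _ _)
        fun f _ _ => kpow_nonneg h0 n f
    _ = (∑ x, θ' x) ^ n := sum_kpow θ' n
    _ ≤ _ := pow_le_pow_left₀ (Finset.sum_nonneg fun x _ => h0 x) h1 n

/-- Cramér-type lower bound for the upper tail, restricted to sequences that leave the support of
each of the columns `w l`. -/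
lemma eventually_le_sum_tail {Λ : Type} [Fintype Λ] {u L : I → ℝ} (hu : IsProb u) {w : Λ → I → ℝ}
    (hw : ∀ l, ∃ a, u a ≠ 0 ∧ w l a = 0) (c₁ : ℝ) {ε : ℝ} (hε : 0 < ε) :
    ∀ᶠ n : ℕ in Filter.atTop, ∀ c τ, 0 ≤ c → c ≤ c₁ →
      0 ≤ ∑ x, u x * Real.exp (c * L x) * (L x - (τ + ε)) →
      c * ∑ x, u x * Real.exp (c * L x) * (L x - (τ + ε)) = 0 →
      (expMoment u L c * Real.exp (-(c * (τ + 2 * ε)))) ^ n ≤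
        2 * ∑ f with (∀ l, kpow (w l) n f = 0) ∧ n * τ ≤ ∑ j, L (f j), kpow u n f := by
  choose a ha hwa using hw
  obtain ⟨B, hB⟩ : ∃ B, ∀ x, |L x| ≤ B := ⟨∑ x, |L x|, fun x =>
    Finset.single_le_sum (f := fun x => |L x|) (fun _ _ => abs_nonneg _) (Finset.mem_univ x)⟩
  have hB0 : 0 ≤ B := by
    obtain ⟨x, -⟩ := Finset.exists_ne_zero_of_sum_ne_zero (s := Finset.univ) (f := u)
      (by rw [hu.2]; exact one_ne_zero)
    exact (abs_nonneg _).trans (hB x)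
  set ρ : Λ → ℝ := fun l => u (a l) * Real.exp (-(2 * (c₁ * B))) with hρ
  have hρ0 : ∀ l, 0 < ρ l := fun l =>
    mul_pos (lt_of_le_of_ne (hu.1 _) (ha l).symm) (Real.exp_pos _)
  have hlim : ∀ᶠ n : ℕ in Filter.atTop, ∀ l, Fintype.card Λ * max 0 (1 - ρ l) ^ n ≤ 1 / 4 := by
    refine Filter.eventually_all.2 fun l => ?_
    have h1 : Filter.Tendsto (fun n : ℕ => (Fintype.card Λ : ℝ) * max 0 (1 - ρ l) ^ n)
        Filter.atTop (nhds (Fintype.card Λ * 0)) :=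
      (tendsto_pow_atTop_nhds_zero_of_lt_one (le_max_left _ _)
        (max_lt one_pos (by linarith [hρ0 l]))).const_mul _
    rw [mul_zero] at h1
    exact h1.eventually_le_const (by norm_num)
  filter_upwards [eventually_le_sum_kpow_filter (I := I) Unit (2 * B) hε
    (show (0 : ℝ) < 1 / 4 by norm_num), hlim] with n hn hlim c τ hc0 hc1 hS hcS
  set W := expMoment u L c with hW
  have hW0 : 0 < W := expMoment_pos hu L c
  set θ : I → ℝ := fun x => u x * Real.exp (c * L x) / W with hθ
  have hθ0 : ∀ x, 0 ≤ θ x := fun x => div_nonneg (mul_nonneg (hu.1 x) (Real.exp_pos _).le) hW0.le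
  have hθ1 : ∑ x, θ x = 1 := by
    rw [← Finset.sum_div]; exact div_self hW0.ne'
  have hθP : IsProb θ := ⟨hθ0, hθ1⟩
  set e := ∑ x, θ x * L x with he
  have heS : e - (τ + ε) = (∑ x, u x * Real.exp (c * L x) * (L x - (τ + ε))) / W := by
    calc e - (τ + ε) = ∑ x, θ x * (L x - (τ + ε)) := by
          simp only [mul_sub _ (L _), Finset.sum_sub_distrib]
          rw [← Finset.sum_mul, hθ1, one_mul]
      _ = _ := by
        rw [Finset.sum_div]
        exact Finset.sum_congr rfl fun x _ => by simp only [hθ]; ring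
  have he1 : τ + ε ≤ e := by
    have := div_nonneg hS hW0.le
    rw [← heS] at this
    linarith
  have he2 : c * e = c * (τ + ε) := by
    have : c * (e - (τ + ε)) = 0 := by rw [heS, mul_div_assoc', hcS, zero_div]
    linarith
  have heB : |e| ≤ B := abs_sum_mul_le hθ0 hθ1 hB
  have hθa : ∀ l, ρ l ≤ θ (a l) := fun l => by
    have hWB : W ≤ Real.exp (c₁ * B) := by
      calc W ≤ ∑ x, u x * Real.exp (c₁ * B) := by
            refine Finset.sum_le_sum fun x _ => mul_le_mul_of_nonneg_left
              (Real.exp_le_exp.2 ?_) (hu.1 x)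
            exact (mul_le_mul_of_nonneg_left ((le_abs_self _).trans (hB x)) hc0).trans
              (mul_le_mul_of_nonneg_right hc1 hB0)
        _ = _ := by rw [← Finset.sum_mul, hu.2, one_mul]
    have hLB : Real.exp (-(c₁ * B)) ≤ Real.exp (c * L (a l)) := by
      rw [Real.exp_le_exp]
      have h1 := (abs_le.1 (hB (a l))).1
      nlinarith
    simp only [hρ, hθ]
    rw [le_div_iff₀ hW0, mul_assoc]
    refine mul_le_mul_of_nonneg_left ?_ (hu.1 _)
    calc Real.exp (-(2 * (c₁ * B))) * W ≤ Real.exp (-(2 * (c₁ * B))) * Real.exp (c₁ * B) :=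
          mul_le_mul_of_nonneg_left hWB (Real.exp_pos _).le
      _ = Real.exp (-(c₁ * B)) := by rw [← Real.exp_add]; ring_nf
      _ ≤ _ := hLB
  have h1 := hn θ (fun _ x => L x - e) hθP
    (fun _ => by
      simp only [mul_sub _ (L _), Finset.sum_sub_distrib]
      rw [← Finset.sum_mul, hθ1, one_mul, sub_self])
    (fun _ x => (abs_sub _ _).trans (by linarith [hB x]))
  have h2 : ∑ l, ∑ f with kpow (w l) n f ≠ 0, kpow θ n f ≤ 1 / 4 := by
    rcases isEmpty_or_nonempty Λ with hΛ | hΛ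
    · simp
    have hcard : (0 : ℝ) < Fintype.card Λ := Nat.cast_pos.2 Fintype.card_pos
    calc ∑ l, ∑ f with kpow (w l) n f ≠ 0, kpow θ n f ≤ ∑ l : Λ, 1 / 4 / (Fintype.card Λ : ℝ) := by
          refine Finset.sum_le_sum fun l _ => ?_
          rw [le_div_iff₀ hcard, mul_comm]
          refine le_trans (mul_le_mul_of_nonneg_left
            ((sum_filter_kpow_ne_zero_le hθP (hwa l) n).trans ?_) hcard.le) (hlim l)
          have h3 : θ (a l) ≤ 1 := by
            rw [← hθ1]
            exact Finset.single_le_sum (fun x _ => hθ0 x) (Finset.mem_univ _)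
          refine pow_le_pow_left₀ (by linarith) ?_ n
          exact (by linarith [hθa l] : 1 - θ (a l) ≤ 1 - ρ l).trans (le_max_right _ _)
      _ = 1 / 4 := by
        rw [Finset.sum_const, Finset.card_univ, nsmul_eq_mul]; field_simp
  set G : Finset (Fin n → I) := Finset.univ.filter fun f =>
    (∀ l, kpow (w l) n f = 0) ∧ n * τ ≤ ∑ j, L (f j) with hG
  set G' : Finset (Fin n → I) := Finset.univ.filter fun f =>
    (∀ l, kpow (w l) n f = 0) ∧ |∑ j, (L (f j) - e)| < n * ε with hG'
  have hkn := fun f => kpow_nonneg hθ0 n f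
  have h3 : 1 / 2 ≤ ∑ f ∈ G', kpow θ n f := by
    have h4 : ∑ f with ∀ _ : Unit, |∑ j, (L (f j) - e)| < n * ε, kpow θ n f ≤
        ∑ f ∈ G', kpow θ n f + ∑ l, ∑ f with kpow (w l) n f ≠ 0, kpow θ n f := by
      rw [Finset.sum_filter, hG', Finset.sum_filter]
      simp only [Finset.sum_filter]
      rw [Finset.sum_comm, ← Finset.sum_add_distrib]
      refine Finset.sum_le_sum fun f _ => ?_
      have hnn : ∀ l, 0 ≤ if kpow (w l) n f ≠ 0 then kpow θ n f else 0 := fun l => by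
        split_ifs; exacts [hkn f, le_rfl]
      have hnn' := Finset.sum_nonneg fun l (_ : l ∈ Finset.univ) => hnn l
      by_cases hb : |∑ j, (L (f j) - e)| < n * ε
      · by_cases hl : ∀ l, kpow (w l) n f = 0
        · simp [hl]
        · push Not at hl
          obtain ⟨l, hl⟩ := hl
          have h5 := Finset.single_le_sum (fun l _ => hnn l) (Finset.mem_univ l)
          rw [if_pos hl] at h5
          rw [if_pos fun _ => hb]
          refine h5.trans (le_add_of_nonneg_left ?_)
          split_ifs
          exacts [hkn f, le_rfl]
      · simp only [hb, and_false, if_false, zero_add, forall_const]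
        exact hnn'
    linarith
  have h4 : ∀ f ∈ G', (W * Real.exp (-(c * (τ + 2 * ε)))) ^ n * kpow θ n f ≤ kpow u n f := by
    intro f hf
    have hf2 := (abs_lt.1 (Finset.mem_filter.1 hf).2.2).2
    rw [Finset.sum_sub_distrib, Finset.sum_const, Finset.card_univ, Fintype.card_fin,
      nsmul_eq_mul] at hf2
    have h5 : W ^ n * kpow θ n f = kpow u n f * Real.exp (c * ∑ j, L (f j)) := by
      rw [← kpow_mul_exp, kpow, kpow, ← Fin.prod_const, ← Finset.prod_mul_distrib]
      refine Finset.prod_congr rfl fun j _ => ?_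
      simp only [hθ]
      field_simp
    have h6 : c * ∑ j, L (f j) ≤ n * (c * (τ + 2 * ε)) := by
      have := mul_le_mul_of_nonneg_left hf2.le hc0
      nlinarith
    calc (W * Real.exp (-(c * (τ + 2 * ε)))) ^ n * kpow θ n f
        = kpow u n f * (Real.exp (c * ∑ j, L (f j)) * Real.exp (-(n * (c * (τ + 2 * ε))))) := by
          rw [mul_pow, ← Real.exp_nat_mul, mul_right_comm, h5, mul_neg, mul_assoc]
      _ ≤ kpow u n f * 1 := by
          refine mul_le_mul_of_nonneg_left ?_ (kpow_nonneg hu.1 n f)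
          rw [← Real.exp_add, Real.exp_le_one_iff]
          linarith
      _ = _ := mul_one _
  have h5 : G' ⊆ G := by
    intro f hf
    have hf2 := (abs_lt.1 (Finset.mem_filter.1 hf).2.2).1
    rw [Finset.sum_sub_distrib, Finset.sum_const, Finset.card_univ, Fintype.card_fin,
      nsmul_eq_mul] at hf2
    refine Finset.mem_filter.2 ⟨Finset.mem_univ f, (Finset.mem_filter.1 hf).2.1, ?_⟩
    nlinarith [mul_le_mul_of_nonneg_left he1 (Nat.cast_nonneg (α := ℝ) n)]
  have h6 : (W * Real.exp (-(c * (τ + 2 * ε)))) ^ n * ∑ f ∈ G', kpow θ n f ≤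
      ∑ f ∈ G, kpow u n f := by
    rw [Finset.mul_sum]
    exact (Finset.sum_le_sum h4).trans
      (Finset.sum_le_sum_of_subset_of_nonneg h5 fun f _ _ => kpow_nonneg hu.1 n f)
  have h7 : 0 < (W * Real.exp (-(c * (τ + 2 * ε)))) ^ n :=
    pow_pos (mul_pos hW0 (Real.exp_pos _)) n
  nlinarith

/-- Chernoff upper bound for the upper tail. -/
lemma sum_tail_le {u L : I → ℝ} (hu : IsProb u) {c : ℝ} (hc : 0 ≤ c) (n : ℕ) (τ b : ℝ) :
    ∑ f : Fin n → I with n * τ ≤ b + ∑ j, L (f j), kpow u n f ≤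
      Real.exp (c * b) * (expMoment u L c * Real.exp (-(c * τ))) ^ n := by
  calc ∑ f : Fin n → I with n * τ ≤ b + ∑ j, L (f j), kpow u n f
      ≤ ∑ f : Fin n → I with n * τ ≤ b + ∑ j, L (f j),
        Real.exp (c * (b - n * τ)) * kpow (fun x => u x * Real.exp (c * L x)) n f := by
        refine Finset.sum_le_sum fun f hf => ?_
        have hf := (Finset.mem_filter.1 hf).2
        rw [kpow_mul_exp, mul_left_comm, ← Real.exp_add]
        refine le_mul_of_one_le_right (kpow_nonneg hu.1 n f) (Real.one_le_exp ?_)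
        rw [← mul_add]
        exact mul_nonneg hc (by linarith)
    _ ≤ ∑ f, Real.exp (c * (b - n * τ)) * kpow (fun x => u x * Real.exp (c * L x)) n f :=
        Finset.sum_le_sum_of_subset_of_nonneg (Finset.filter_subset _ _) fun f _ _ =>
          mul_nonneg (Real.exp_pos _).le
            (kpow_nonneg (fun x => mul_nonneg (hu.1 x) (Real.exp_pos _).le) n f)
    _ = _ := by
        rw [← Finset.mul_sum, sum_kpow, mul_pow, ← Real.exp_nat_mul, mul_left_comm, ← Real.exp_add,
          expMoment, mul_comm]
        ring_nf

lemma exists_expMoment_gap {u L : I → ℝ} {u' L' : J → ℝ} (hu : IsProb u) (hu' : IsProb u')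
    {τ₀ : ℝ} (hτ₀ : ∑ y, u' y * L' y < τ₀) (h : ∀ c > 0, expMoment u' L' c < expMoment u L c)
    {c₁ : ℝ} (hc₁ : 0 ≤ c₁) (T : ℝ) :
    ∃ δ > 0, ∃ c₂, ∀ c, 0 ≤ c → c ≤ c₁ → ∀ τ, τ₀ ≤ τ → τ ≤ T → ∃ c', 0 ≤ c' ∧ c' ≤ c₂ ∧
      expMoment u' L' c' * Real.exp (-(c' * τ)) ≤
        Real.exp (-δ) * (expMoment u L c * Real.exp (-(c * τ))) := by
  have hder : HasDerivAt (fun c => expMoment u' L' c * Real.exp (-(c * τ₀)))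
      (∑ y, u' y * (L' y - τ₀)) 0 := by
    have e : (fun c => expMoment u' L' c * Real.exp (-(c * τ₀))) =
        fun c => ∑ y, u' y * Real.exp (c * (L' y - τ₀)) := by
      funext c
      rw [expMoment, Finset.sum_mul]
      refine Finset.sum_congr rfl fun y _ => ?_
      rw [mul_assoc, ← Real.exp_add]; ring_nf
    rw [e]
    refine HasDerivAt.fun_sum fun y _ => ?_
    have h1 : HasDerivAt (fun c : ℝ => c * (L' y - τ₀)) (1 * (L' y - τ₀)) 0 :=
      (hasDerivAt_id 0).mul_const _
    simpa using h1.exp.const_mul (u' y)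
  obtain ⟨η, hη0, -, hlt⟩ := hder.exists_lt_of_neg (δ := 1) (by
    simp only [mul_sub, Finset.sum_sub_distrib]
    rw [← Finset.sum_mul, hu'.2]; linarith) one_pos
  simp only [expMoment_zero hu', zero_mul, neg_zero, Real.exp_zero, mul_one] at hlt
  set A := expMoment u' L' η * Real.exp (-(η * τ₀)) with hA
  have hA0 : 0 < A := mul_pos (expMoment_pos hu' L' η) (Real.exp_pos _)
  set g : ℝ → ℝ := fun c => max (expMoment u L c / expMoment u' L' c)
    (expMoment u L c * Real.exp (-(c * T)) / A) with hg
  have hgc : Continuous g := by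
    have h1 := continuous_expMoment u L
    have h2 := continuous_expMoment u' L'
    refine (h1.div h2 fun c => (expMoment_pos hu' L' c).ne').max ?_
    exact (h1.mul (by fun_prop)).div_const _
  obtain ⟨c₀, hc₀, hmin⟩ := isCompact_Icc.exists_isMinOn (Set.nonempty_Icc.2 hc₁) hgc.continuousOn
  have hg1 : 1 < g c₀ := by
    rcases hc₀.1.eq_or_lt with h0 | h0
    · rw [← h0]
      refine lt_max_of_lt_right ?_
      rw [one_lt_div hA0]
      simpa [expMoment_zero hu] using hlt
    · exact lt_max_of_lt_left ((one_lt_div (expMoment_pos hu' L' _)).2 (h _ h0))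
  refine ⟨Real.log (g c₀), Real.log_pos hg1, max c₁ η, fun c hc0 hc1 τ hτ1 hτ2 => ?_⟩
  have hle := isMinOn_iff.1 hmin c ⟨hc0, hc1⟩
  rw [← Real.exp_log (one_pos.trans hg1)] at hle
  rcases le_max_iff.1 hle with h1 | h1
  · refine ⟨c, hc0, hc1.trans (le_max_left _ _), ?_⟩
    rw [← mul_assoc]
    exact mul_le_mul_of_nonneg_right (le_exp_neg_mul (expMoment_pos hu' L' c) h1)
      (Real.exp_pos _).le
  · refine ⟨η, hη0.le, le_max_right _ _, ?_⟩
    calc expMoment u' L' η * Real.exp (-(η * τ)) ≤ A :=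
          mul_le_mul_of_nonneg_left (Real.exp_le_exp.2 (by nlinarith)) (expMoment_pos hu' L' η).le
      _ ≤ _ := le_exp_neg_mul hA0 h1
      _ ≤ _ := by
          refine mul_le_mul_of_nonneg_left (mul_le_mul_of_nonneg_left
            (Real.exp_le_exp.2 (by nlinarith)) (expMoment_pos hu L c).le) (Real.exp_pos _).le

/-- The upper tail of the second law is exponentially smaller than the upper tail of the first
one, uniformly in the threshold. -/
lemma eventually_sum_tail_le_sum_tail {Λ : Type} [Fintype Λ] {u L : I → ℝ} {u' L' : J → ℝ}
    (hu : IsProb u) (hu' : IsProb u') {w : Λ → I → ℝ} (hw : ∀ l, ∃ a, u a ≠ 0 ∧ w l a = 0)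
    {τ₀ : ℝ} (hτ₀ : ∑ y, u' y * L' y < τ₀) (h : ∀ c > 0, expMoment u' L' c < expMoment u L c)
    {a : I} (ha : u a ≠ 0) {D : ℝ} (hD : ∀ y, u' y ≠ 0 → L' y ≤ D) (hDa : D < L a)
    (b C : ℝ) (m : ℕ) :
    ∀ᶠ n : ℕ in Filter.atTop, ∀ τ, τ₀ ≤ τ →
      C * (n + 1) ^ m * ∑ g : Fin n → J with n * τ ≤ b + ∑ j, L' (g j), kpow u' n g ≤
        ∑ f with (∀ l, kpow (w l) n f = 0) ∧ n * τ ≤ ∑ j, L (f j), kpow u n f := by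
  obtain ⟨D', hD1, hD2⟩ := exists_between hDa
  obtain ⟨c₁, hc₁, H₁⟩ := exists_tilt_mean_ge hu (lt_of_le_of_ne (hu.1 a) ha.symm) hD2
  obtain ⟨δ, hδ, c₂, H₂⟩ := exists_expMoment_gap hu hu' hτ₀ h hc₁.le D'
  obtain ⟨ε, hε, hε1, hε2⟩ : ∃ ε > 0, ε < D' - D ∧ c₁ * (2 * ε) ≤ δ / 2 := by
    refine ⟨min ((D' - D) / 2) (δ / (4 * c₁)), lt_min (by linarith) (by positivity),
      (min_le_left _ _).trans_lt (by linarith), ?_⟩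
    calc c₁ * (2 * min ((D' - D) / 2) (δ / (4 * c₁))) ≤ c₁ * (2 * (δ / (4 * c₁))) := by
          gcongr; exact min_le_right _ _
      _ = δ / 2 := by field_simp; ring
  filter_upwards [eventually_le_sum_tail (L := L) hu hw c₁ hε,
    eventually_mul_pow_le_exp (2 * |C| * Real.exp (c₂ * |b|)) m (half_pos hδ),
    (tendsto_natCast_atTop_atTop (R := ℝ)).eventually_gt_atTop (b / (D' - D - ε))]
    with n h1 h2 h3 τ hτ
  have hR : 0 ≤ ∑ f with (∀ l, kpow (w l) n f = 0) ∧ n * τ ≤ ∑ j, L (f j), kpow u n f :=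
    Finset.sum_nonneg fun f _ => kpow_nonneg hu.1 n f
  have hL : 0 ≤ ∑ g : Fin n → J with n * τ ≤ b + ∑ j, L' (g j), kpow u' n g :=
    Finset.sum_nonneg fun f _ => kpow_nonneg hu'.1 n f
  by_cases hτD : τ + ε ≤ D'
  · obtain ⟨c, hc0, hc1, hS, hcS⟩ := H₁ _ hτD
    obtain ⟨c', hc'0, hc'1, hgap⟩ := H₂ c hc0 hc1 τ hτ (by linarith)
    have h4 := h1 c τ hc0 hc1 hS hcS
    have h5 := sum_tail_le (L := L') hu' hc'0 n τ b
    set E := expMoment u L c * Real.exp (-(c * τ)) with hE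
    have hE0 : 0 < E := mul_pos (expMoment_pos hu L c) (Real.exp_pos _)
    have h6 : E ^ n * Real.exp (-(n * (δ / 2))) ≤
        (expMoment u L c * Real.exp (-(c * (τ + 2 * ε)))) ^ n := by
      rw [hE, mul_pow, mul_pow, mul_assoc, ← Real.exp_nat_mul, ← Real.exp_nat_mul, ← Real.exp_add]
      refine mul_le_mul_of_nonneg_left (Real.exp_le_exp.2 ?_)
        (pow_nonneg (expMoment_pos hu L c).le n)
      have : c * (2 * ε) ≤ δ / 2 := (mul_le_mul_of_nonneg_right hc1 (by linarith)).trans hε2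
      nlinarith [mul_le_mul_of_nonneg_left this (Nat.cast_nonneg (α := ℝ) n)]
    have h7 : ∑ g : Fin n → J with n * τ ≤ b + ∑ j, L' (g j), kpow u' n g ≤
        Real.exp (c₂ * |b|) * (Real.exp (-(n * δ)) * E ^ n) := by
      refine h5.trans (mul_le_mul ?_ ?_ ?_ (Real.exp_pos _).le)
      · refine Real.exp_le_exp.2 ?_
        exact (mul_le_mul_of_nonneg_left (le_abs_self b) hc'0).trans
          (mul_le_mul_of_nonneg_right hc'1 (abs_nonneg b))
      · refine (pow_le_pow_left₀ (mul_pos (expMoment_pos hu' L' c') (Real.exp_pos _)).le hgap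
          n).trans (le_of_eq ?_)
        rw [mul_pow, ← Real.exp_nat_mul, mul_neg]
      · exact pow_nonneg (mul_pos (expMoment_pos hu' L' c') (Real.exp_pos _)).le n
    have h8 : 2 * (C * (n + 1) ^ m * ∑ g : Fin n → J with n * τ ≤ b + ∑ j, L' (g j),
        kpow u' n g) ≤ E ^ n * Real.exp (-(n * (δ / 2))) := by
      calc _ ≤ 2 * (|C| * (n + 1) ^ m * (Real.exp (c₂ * |b|) * (Real.exp (-(n * δ)) * E ^ n))) := by
            gcongr
            exact le_abs_self C
        _ = 2 * |C| * Real.exp (c₂ * |b|) * (n + 1) ^ m * (Real.exp (-(n * δ)) * E ^ n) := by ring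
        _ ≤ Real.exp (n * (δ / 2)) * (Real.exp (-(n * δ)) * E ^ n) := by gcongr
        _ = _ := by
          rw [← mul_assoc, ← Real.exp_add, mul_comm]; ring_nf
    linarith
  · refine le_trans (le_of_eq ?_) hR
    rw [Finset.sum_eq_zero, mul_zero]
    intro g hg
    by_contra hne
    have h4 : ∑ j, L' (g j) ≤ n * D := by
      calc ∑ j, L' (g j) ≤ ∑ _j : Fin n, D :=
            Finset.sum_le_sum fun j _ => hD _ (kpow_ne_zero_iff.1 hne j)
        _ = _ := by simp
    have h5 := (Finset.mem_filter.1 hg).2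
    have h6 : 0 < D' - D - ε := by linarith
    rw [div_lt_iff₀ h6] at h3
    have h7 : (n : ℝ) * (D' - ε) ≤ n * τ :=
      mul_le_mul_of_nonneg_left (by linarith) (Nat.cast_nonneg n)
    nlinarith

end Tails

section Assembly

variable {I J : Type} [Fintype I] [Fintype J] {d : ℕ}

lemma convexOn_sup'_affine {ι : Type} (s : Finset ι) (hs : s.Nonempty) (v : ι → Fin d → ℝ)
    (c : ι → ℝ) : ConvexOn ℝ Set.univ fun y : Fin d → ℝ => s.sup' hs fun g =>
      ∑ k, v g k * y k + c g := by
  refine ⟨convex_univ, fun x _ y _ a b ha hb hab => Finset.sup'_le _ _ fun g hg => ?_⟩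
  have e : ∑ k, v g k * (a • x + b • y) k + c g =
      a * (∑ k, v g k * x k + c g) + b * (∑ k, v g k * y k + c g) := by
    simp only [Pi.add_apply, Pi.smul_apply, smul_eq_mul, mul_add, Finset.sum_add_distrib,
      Finset.mul_sum]
    have h1 : c g = a * c g + b * c g := by rw [← add_mul, hab, one_mul]
    have h2 : ∀ z : Fin d → ℝ, ∀ r : ℝ, ∑ k, v g k * (r * z k) = ∑ k, r * (v g k * z k) :=
      fun z r => Finset.sum_congr rfl fun k _ => by ring
    rw [h2, h2]
    linarith
  rw [e, smul_eq_mul, smul_eq_mul]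
  exact add_le_add
    (mul_le_mul_of_nonneg_left (Finset.le_sup' (fun g => ∑ k, v g k * x k + c g) hg) ha)
    (mul_le_mul_of_nonneg_left (Finset.le_sup' (fun g => ∑ k, v g k * y k + c g) hg) hb)

/-- A sufficient condition for the existence of a stochastic map, in terms of the ratios to the
dominating column. -/
lemma exists_isStoch_of_ratio_tails [Nonempty J] (hd : 1 ≤ d)
    {p : Fin (d + 1) → I → ℝ} {q : Fin (d + 1) → J → ℝ}
    (hp : ∀ k, IsProb (p k)) (hq : ∀ k, IsProb (q k))
    (hpdom : ∀ (k : Fin d) x, p k.castSucc x ≠ 0 → p (Fin.last d) x ≠ 0)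
    (hqdom : ∀ (k : Fin d) y, q k.castSucc y ≠ 0 → q (Fin.last d) y ≠ 0)
    {t : Fin d → ℝ} (ht : ∀ k, 0 < t k)
    {z : I → Fin d → ℝ} (hz : ∀ i k, z i k = p k.castSucc i / (p (Fin.last d) i * t k))
    {u : J → Fin d → ℝ} (hu : ∀ j k, u j k = q k.castSucc j / (q (Fin.last d) j * t k))
    {M : ℝ} (hX : ((Finset.univ.image z).card : ℝ) ≤ M)
    (hV : ∀ k, ((Finset.univ.image fun j => u j k).card : ℝ) ≤ M)
    (hA : ∀ k, ∀ x : ℝ, 1 ≤ x →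
      2 * d ^ 2 * M * ∑ j with x ≤ 2 * d * u j k, q k.castSucc j ≤
        ∑ i with (∀ l, l ≠ k → z i l = 0) ∧ x ≤ z i k, p k.castSucc i)
    (hB : ∀ i, z i ≠ 0 → (∀ k, (∀ l, l ≠ k → z i l = 0) → z i k < 1) →
      ∃ c : J → ℝ, (∀ j, 0 ≤ c j) ∧ (∀ j, c j ≤ q (Fin.last d) j) ∧
        (∀ j k, c j * z i k ≤ q (Fin.last d) j * u j k) ∧
        2 * M * ∑ i' with z i' = z i, p (Fin.last d) i' ≤ ∑ j, c j) :
    ∃ T : J → I → ℝ, IsStoch T ∧ ∀ k y, ∑ x, T y x * p k x = q k y := by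
  have hpz : ∀ i k, p (Fin.last d) i * z i k = p k.castSucc i / t k := fun i k => by
    have := (ht k).ne'
    by_cases h0 : p (Fin.last d) i = 0
    · have h1 : p k.castSucc i = 0 := by
        by_contra h; exact hpdom k i h h0
      simp [h0, h1]
    · rw [hz]; field_simp
  have hqu : ∀ j k, q (Fin.last d) j * u j k = q k.castSucc j / t k := fun j k => by
    have := (ht k).ne'
    by_cases h0 : q (Fin.last d) j = 0
    · have h1 : q k.castSucc j = 0 := by
        by_contra h; exact hqdom k j h h0
      simp [h0, h1]
    · rw [hu]; field_simp
  refine exists_isStoch_of_forall_sum_le p q fun w => ?_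
  set F₀ : (Fin d → ℝ) → ℝ := fun y => Finset.univ.sup' Finset.univ_nonempty fun g =>
    ∑ k : Fin d, (w g k.castSucc * t k) * y k + w g (Fin.last d) with hF₀
  have hF₀c : ConvexOn ℝ Set.univ F₀ := convexOn_sup'_affine _ _ _ _
  set β : Fin d → ℝ := fun k => F₀ (Pi.single k 1) - F₀ 0 with hβ
  set F : (Fin d → ℝ) → ℝ := fun y => F₀ y - (F₀ 0 + ∑ k, β k * y k) with hF
  have hFc : ConvexOn ℝ Set.univ F := by
    refine ⟨convex_univ, fun x hx y hy a b ha hb hab => ?_⟩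
    have h1 := hF₀c.2 hx hy ha hb hab
    have e : F₀ 0 + ∑ k, β k * (a • x + b • y) k =
        a * (F₀ 0 + ∑ k, β k * x k) + b * (F₀ 0 + ∑ k, β k * y k) := by
      simp only [Pi.add_apply, Pi.smul_apply, smul_eq_mul, mul_add, Finset.sum_add_distrib,
        Finset.mul_sum]
      have h1 : F₀ 0 = a * F₀ 0 + b * F₀ 0 := by rw [← add_mul, hab, one_mul]
      have h2 : ∀ z : Fin d → ℝ, ∀ r : ℝ, ∑ k, β k * (r * z k) = ∑ k, r * (β k * z k) :=
        fun z r => Finset.sum_congr rfl fun k _ => by ring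
      rw [h2, h2]
      linarith
    simp only [hF, smul_eq_mul] at h1 ⊢
    rw [e]
    linarith
  have hF0 : F 0 = 0 := by simp [hF]
  have hF1 : ∀ k, F (Pi.single k 1) = 0 := fun k => by
    have : ∑ l, β l * (Pi.single k 1 : Fin d → ℝ) l = β k := by simp [Pi.single_apply]
    simp only [hF]
    rw [this]
    simp only [hβ]
    ring
  have hdiv : ∀ k, ∀ a b c : ℝ, a * b ≤ c → a * (b / t k) ≤ c / t k := fun k a b c h => by
    rw [mul_div_assoc']
    exact div_le_div_of_nonneg_right h (ht k).le
  have hcore := sum_mul_le_sum_mul_of_tails hd hFc hF0 hF1 (hp (Fin.last d)).1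
    (hq (Fin.last d)).1 (z := z) (u := u)
    (fun i k => by
      rw [hz]
      exact div_nonneg ((hp _).1 i) (mul_nonneg ((hp _).1 i) (ht k).le))
    (fun j k => by
      rw [hu]
      exact div_nonneg ((hq _).1 j) (mul_nonneg ((hq _).1 j) (ht k).le)) hX hV
    (fun k x hx => by
      simp only [hpz, hqu, ← Finset.sum_div]
      exact hdiv k _ _ _ (hA k x hx)) hB
  have hsumF : ∀ {ι : Type} [Fintype ι] (y : ι → Fin d → ℝ) (r : Fin (d + 1) → ι → ℝ),
      (∀ k, IsProb (r k)) → (∀ i k, r (Fin.last d) i * y i k = r k.castSucc i / t k) →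
      ∑ i, r (Fin.last d) i * F (y i) =
        ∑ i, r (Fin.last d) i * F₀ (y i) - (F₀ 0 + ∑ k, β k * (1 / t k)) := by
    intro ι _ y r hr hy
    have e : ∀ i, r (Fin.last d) i * F (y i) = r (Fin.last d) i * F₀ (y i) -
        (r (Fin.last d) i * F₀ 0 + ∑ k, r k.castSucc i * (β k / t k)) := fun i => by
      have : ∑ k, r k.castSucc i * (β k / t k) = r (Fin.last d) i * ∑ k, β k * y i k := by
        rw [Finset.mul_sum]
        refine Finset.sum_congr rfl fun k _ => ?_
        rw [mul_left_comm, hy]; ring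
      rw [this]
      simp only [hF]
      ring
    simp only [e, Finset.sum_sub_distrib, Finset.sum_add_distrib]
    rw [Finset.sum_comm, ← Finset.sum_mul, (hr _).2, one_mul]
    simp only [← Finset.sum_mul, (hr _).2, one_mul, mul_one_div]
  rw [hsumF u q hq hqu, hsumF z p hp hpz] at hcore
  have hval : ∀ {ι : Type} (y : ι → Fin d → ℝ) (r : Fin (d + 1) → ι → ℝ) (g : J) (i : ι),
      (∀ i k, r (Fin.last d) i * y i k = r k.castSucc i / t k) →
      ∑ k, w g k * r k i = r (Fin.last d) i *
        (∑ k : Fin d, (w g k.castSucc * t k) * y i k + w g (Fin.last d)) := by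
    intro ι y r g i hy
    rw [Fin.sum_univ_castSucc, mul_add, Finset.mul_sum, mul_comm (w g (Fin.last d))]
    congr 1
    refine Finset.sum_congr rfl fun k _ => ?_
    rw [mul_left_comm, hy]
    have := (ht k).ne'
    field_simp
  calc ∑ g, ∑ k, w g k * q k g ≤ ∑ g, q (Fin.last d) g * F₀ (u g) := by
        refine Finset.sum_le_sum fun g _ => ?_
        rw [hval u q g g hqu]
        exact mul_le_mul_of_nonneg_left (Finset.le_sup' (fun g' => ∑ k : Fin d,
          (w g' k.castSucc * t k) * u g k + w g' (Fin.last d)) (Finset.mem_univ g)) ((hq _).1 g)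
    _ ≤ ∑ i, p (Fin.last d) i * F₀ (z i) := by linarith
    _ ≤ _ := by
        refine Finset.sum_le_sum fun i _ => ?_
        obtain ⟨g, -, hg⟩ := Finset.exists_mem_eq_sup' Finset.univ_nonempty fun g =>
          ∑ k : Fin d, (w g k.castSucc * t k) * z i k + w g (Fin.last d)
        rw [show F₀ (z i) = _ from hg, ← hval z p g i hpz]
        exact Finset.le_sup' (fun g => ∑ k, w g k * p k i) (Finset.mem_univ g)

lemma IsProb.kpow {r : I → ℝ} (hr : IsProb r) (n : ℕ) : IsProb (kpow r n) :=
  ⟨kpow_nonneg hr.1 n, hr.sum_kpow n⟩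

lemma Dinf_spec {p q : I → ℝ} (hp : IsProb p) (hq : ∀ x, 0 ≤ q x)
    (hpq : ∀ x, p x ≠ 0 → q x ≠ 0) :
    (∀ x, p x ≠ 0 → Real.log (p x / q x) ≤ Dinf p q) ∧
      ∃ x, p x ≠ 0 ∧ Real.log (p x / q x) = Dinf p q := by
  have h : ∃ x, p x ≠ 0 := by
    obtain ⟨x, -, hx⟩ := Finset.exists_ne_zero_of_sum_ne_zero (s := Finset.univ) (f := p)
      (by rw [hp.2]; exact one_ne_zero)
    exact ⟨x, hx⟩
  rw [Dinf, dif_pos h]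
  refine ⟨fun x hx => ?_, ?_⟩
  · refine Real.log_le_log (div_pos (lt_of_le_of_ne (hp.1 x) hx.symm)
      (lt_of_le_of_ne (hq x) (hpq x hx).symm)) ?_
    exact Finset.le_sup' (fun x => p x / q x) (Finset.mem_filter.2 ⟨Finset.mem_univ x, hx⟩)
  · obtain ⟨x, hx, he⟩ := Finset.exists_mem_eq_sup'
      (s := Finset.univ.filter fun x => p x ≠ 0)
      ⟨h.choose, Finset.mem_filter.mpr ⟨Finset.mem_univ _, h.choose_spec⟩⟩ fun x => p x / q x
    exact ⟨x, (Finset.mem_filter.1 hx).2, by rw [he]⟩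

lemma D1_eq_sum (p q : I → ℝ) : D1 p q = ∑ x, p x * Real.log (p x / q x) := by
  rw [D1, Finset.sum_filter]
  refine Finset.sum_congr rfl fun x _ => ?_
  by_cases hx : p x = 0 <;> simp [hx]

lemma phiDC_eq_expMoment {p : Fin (d + 1) → I → ℝ} (hp : ∀ k x, 0 ≤ p k x) {k : Fin d}
    (hpdom : ∀ x, p k.castSucc x ≠ 0 → p (Fin.last d) x ≠ 0) {c : ℝ} (hc : 0 < c) :
    phiDC d (1 + c) k p = expMoment (p k.castSucc)
      (fun x => Real.log (p k.castSucc x / p (Fin.last d) x)) c := by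
  rw [phiDC, expMoment, Finset.sum_filter]
  refine Finset.sum_congr rfl fun x _ => ?_
  by_cases hx : p k.castSucc x = 0
  · rw [hx, Real.zero_rpow (by linarith)]
    simp
  · have h1 := lt_of_le_of_ne (hp _ x) (Ne.symm hx)
    have h2 := lt_of_le_of_ne (hp _ x) (hpdom x hx).symm
    rw [if_pos (hpdom x hx), Real.log_div h1.ne' h2.ne', Real.rpow_def_of_pos h1,
      Real.rpow_def_of_pos h2, ← Real.exp_add]
    calc _ = Real.exp (Real.log (p k.castSucc x)) * Real.exp (c *
          (Real.log (p k.castSucc x) - Real.log (p (Fin.last d) x))) := by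
          rw [← Real.exp_add]; ring_nf
      _ = _ := by rw [Real.exp_log h1]

lemma phiAC_stdBasis (p : Fin d → I → ℝ) (k : Fin d) (C : Finset (Fin d)) :
    phiAC d (stdBasis d k) C p = ∑ x with ∀ c ∈ C, p c x ≠ 0, p k x := by
  refine Finset.sum_congr rfl fun x _ => ?_
  rw [Finset.prod_eq_single k]
  · simp [stdBasis]
  · intro l _ hl
    simp [stdBasis, hl]
  · simp

lemma PhiLT.exists_axis {p : Fin (d + 1) → I → ℝ} {q : Fin (d + 1) → J → ℝ} (h : PhiLT p q)
    (hp : ∀ k, IsProb (p k)) (hq : ∀ k, IsProb (q k)) {k l : Fin d} (hl : l ≠ k) :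
    ∃ a, p k.castSucc a ≠ 0 ∧ p l.castSucc a = 0 := by
  by_contra! hne
  have h1 := h (stdBasis (d + 1) k.castSucc) {k.castSucc, l.castSucc}
    (fun j => by unfold stdBasis; split_ifs <;> norm_num) (by simp [stdBasis])
    (fun j hj => by
      by_cases hjk : j = k.castSucc
      · simp [hjk]
      · simp [stdBasis, hjk] at hj)
    (by
      rintro ⟨j, hj, hC⟩
      have h2 := congrFun hj k.castSucc
      have h3 : k.castSucc = j := by
        by_contra h3; simp [stdBasis, h3] at h2
      have h4 := hC (show l.castSucc ∈ _ by simp)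
      rw [← h3] at h4
      simp [Fin.castSucc_ne_last, hl] at h4)
  rw [phiAC_stdBasis, phiAC_stdBasis] at h1
  have h2 : ∑ x with ∀ c ∈ ({k.castSucc, l.castSucc} : Finset (Fin (d + 1))), p c x ≠ 0,
      p k.castSucc x = 1 := by
    rw [← (hp k.castSucc).2, Finset.sum_filter]
    refine Finset.sum_congr rfl fun x _ => ?_
    by_cases hx : p k.castSucc x = 0
    · simp [hx]
    · simp [hx, hne x hx]
  have h3 : ∑ x with ∀ c ∈ ({k.castSucc, l.castSucc} : Finset (Fin (d + 1))), q c x ≠ 0,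
      q k.castSucc x ≤ 1 := by
    rw [← (hq k.castSucc).2]
    exact Finset.sum_le_sum_of_subset_of_nonneg (Finset.filter_subset _ _)
      fun x _ _ => (hq _).1 x
  linarith

end Assembly

lemma kpow_ne_zero_of_dominated {I : Type} {p q : I → ℝ} (hpq : ∀ x, p x ≠ 0 → q x ≠ 0) {n : ℕ}
    {f : Fin n → I} (hf : kpow p n f ≠ 0) : kpow q n f ≠ 0 :=
  kpow_ne_zero_iff.2 fun j => hpq _ (kpow_ne_zero_iff.1 hf j)

lemma kpow_eq_exp_mul {I : Type} {p q : I → ℝ} (hp : ∀ x, 0 ≤ p x) (hq : ∀ x, 0 ≤ q x)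
    (hpq : ∀ x, p x ≠ 0 → q x ≠ 0) {n : ℕ} {f : Fin n → I} (hf : kpow p n f ≠ 0) :
    kpow p n f = Real.exp (∑ j, Real.log (p (f j) / q (f j))) * kpow q n f := by
  rw [Real.exp_sum, kpow, kpow, ← Finset.prod_mul_distrib]
  refine Finset.prod_congr rfl fun j _ => ?_
  have h1 := kpow_ne_zero_iff.1 hf j
  have h2 := hpq _ h1
  rw [Real.exp_log (div_pos (lt_of_le_of_ne (hp _) h1.symm) (lt_of_le_of_ne (hq _) h2.symm)),
    div_mul_cancel₀ _ h2]

section LargeSample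

variable {I J : Type} [Fintype I] [Fintype J] {d : ℕ}

lemma card_image_kpow_div_le (p : Fin (d + 1) → I → ℝ) (t : Fin d → ℝ) (n : ℕ) {β : Type*}
    (φ : (Fin d → ℝ) → β) :
    (Finset.univ.image fun f : Fin n → I => φ fun k : Fin d =>
      kpow (p k.castSucc) n f / (kpow (p (Fin.last d)) n f * t k)).card ≤
        (n + 1) ^ Fintype.card I := by
  refine card_image_le_of_count _ fun f g h => ?_
  simp only [kpow, prod_comp_eq_prod_pow_card, h]

/-- Exact large-sample majorization. -/
theorem eventually_exists_isStoch_kpow (hd : 1 ≤ d) {p : Fin (d + 1) → I → ℝ}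
    {q : Fin (d + 1) → J → ℝ} (hp : ∀ k, IsProb (p k)) (hq : ∀ k, IsProb (q k))
    (hpsup : ∃ x, ∀ k, p k x ≠ 0) (hqsup : ∃ y, ∀ k, q k y ≠ 0)
    (hpdom : ∀ (k : Fin d) x, p k.castSucc x ≠ 0 → p (Fin.last d) x ≠ 0)
    (hqdom : ∀ (k : Fin d) y, q k.castSucc y ≠ 0 → q (Fin.last d) y ≠ 0)
    (h1 : PhiLT p q)
    (h2 : ∀ (c : Fin d) (α : ℝ), 1 < α → phiDC d α c q < phiDC d α c p)
    (h3 : ∀ k : Fin d,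
      D1 (q k.castSucc) (q (Fin.last d)) < D1 (p k.castSucc) (p (Fin.last d)) ∧
      Dinf (q k.castSucc) (q (Fin.last d)) < Dinf (p k.castSucc) (p (Fin.last d))) :
    ∀ᶠ n in Filter.atTop, ∃ T : (Fin n → J) → (Fin n → I) → ℝ, IsStoch T ∧
      ∀ k g, ∑ f, T g f * kpow (p k) n f = kpow (q k) n g := by
  choose τ hτq hτp using fun k => exists_between (h3 k).1
  have hJ : Nonempty J := ⟨hqsup.choose⟩
  set m := Fintype.card I + Fintype.card J with hm
  have hB := eventually_exists_dominating hp hq hpsup hqsup hpdom hqdom h1 hτp 4 m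
  have hA : ∀ k : Fin d, ∀ᶠ n : ℕ in Filter.atTop, ∀ σ, τ k ≤ σ →
      4 * (d : ℝ) ^ 2 * ((n : ℝ) + 1) ^ m *
        ∑ g : Fin n → J with n * σ ≤ Real.log (2 * d) +
          ∑ j, Real.log (q k.castSucc (g j) / q (Fin.last d) (g j)), kpow (q k.castSucc) n g ≤
      ∑ f : Fin n → I with (∀ l : {l : Fin d // l ≠ k}, kpow (p l.1.castSucc) n f = 0) ∧
        n * σ ≤ ∑ j, Real.log (p k.castSucc (f j) / p (Fin.last d) (f j)),
          kpow (p k.castSucc) n f := by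
    intro k
    obtain ⟨-, a, ha, haD⟩ := Dinf_spec (hp k.castSucc) (hp (Fin.last d)).1 (hpdom k)
    obtain ⟨hD, -⟩ := Dinf_spec (hq k.castSucc) (hq (Fin.last d)).1 (hqdom k)
    refine eventually_sum_tail_le_sum_tail (hp k.castSucc) (hq k.castSucc)
      (w := fun l : {l : Fin d // l ≠ k} => p l.1.castSucc)
      (L := fun x => Real.log (p k.castSucc x / p (Fin.last d) x))
      (L' := fun y => Real.log (q k.castSucc y / q (Fin.last d) y))
      (fun l => h1.exists_axis hp hq l.2) (by rw [← D1_eq_sum]; exact hτq k)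
      (fun c hc => ?_) ha hD (by rw [haD]; exact (h3 k).2) _ _ _
    rw [← phiDC_eq_expMoment (fun k => (hp k).1) (hpdom k) hc,
      ← phiDC_eq_expMoment (fun k => (hq k).1) (hqdom k) hc]
    exact h2 k _ (by linarith)
  filter_upwards [hB, Filter.eventually_all.2 hA, Filter.eventually_gt_atTop 0] with n hB hA hn
  have hn0 : (0 : ℝ) < n := Nat.cast_pos.2 hn
  have hd0 : (0 : ℝ) < d := Nat.cast_pos.2 hd
  set t : Fin d → ℝ := fun k => Real.exp (n * τ k) with ht
  have ht0 : ∀ k, 0 < t k := fun k => Real.exp_pos _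
  set M : ℝ := ((n : ℝ) + 1) ^ Fintype.card I + ((n : ℝ) + 1) ^ Fintype.card J with hM
  have hn1 : (1 : ℝ) ≤ n + 1 := by linarith
  have hM2 : 2 * M ≤ 4 * ((n : ℝ) + 1) ^ m := by
    have e1 : ((n : ℝ) + 1) ^ Fintype.card I ≤ ((n : ℝ) + 1) ^ m :=
      pow_le_pow_right₀ hn1 (Nat.le_add_right _ _)
    have e2 : ((n : ℝ) + 1) ^ Fintype.card J ≤ ((n : ℝ) + 1) ^ m :=
      pow_le_pow_right₀ hn1 (Nat.le_add_left _ _)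
    linarith
  have hp0 := fun k f => kpow_nonneg (hp k).1 n f
  have hq0 := fun k g => kpow_nonneg (hq k).1 n g
  have hpd : ∀ (k : Fin d) f, kpow (p k.castSucc) n f ≠ 0 → kpow (p (Fin.last d)) n f ≠ 0 :=
    fun k f => kpow_ne_zero_of_dominated (hpdom k)
  have hqd : ∀ (k : Fin d) f, kpow (q k.castSucc) n f ≠ 0 → kpow (q (Fin.last d)) n f ≠ 0 :=
    fun k f => kpow_ne_zero_of_dominated (hqdom k)
  refine exists_isStoch_of_ratio_tails hd (p := fun k => kpow (p k) n) (q := fun k => kpow (q k) n)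
    (fun k => (hp k).kpow n) (fun k => (hq k).kpow n) hpd hqd ht0
    (z := fun f k => kpow (p k.castSucc) n f / (kpow (p (Fin.last d)) n f * t k))
    (fun _ _ => rfl)
    (u := fun g k => kpow (q k.castSucc) n g / (kpow (q (Fin.last d)) n g * t k))
    (fun _ _ => rfl) (M := M) ?_ ?_ ?_ ?_
  · refine le_trans (Nat.cast_le.2 (le_trans (le_of_eq (by congr!))
      (card_image_kpow_div_le p t n fun y => y))) ?_
    have h0 : (0 : ℝ) ≤ ((n : ℝ) + 1) ^ Fintype.card J := by positivity
    push_cast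
    linarith
  · intro k
    have : ((Finset.univ.image fun g : Fin n → J =>
        kpow (q k.castSucc) n g / (kpow (q (Fin.last d)) n g * t k)).card : ℝ) ≤
        ((n : ℝ) + 1) ^ Fintype.card J := by
      exact_mod_cast card_image_kpow_div_le q t n fun y => y k
    have h0 : (0 : ℝ) ≤ ((n : ℝ) + 1) ^ Fintype.card I := by positivity
    linarith
  · intro k x hx
    have hx0 : 0 < x := by linarith
    have hσ := hA k (τ k + Real.log x / n) (le_add_of_nonneg_right (div_nonneg (Real.log_nonneg hx)
      hn0.le))
    rw [mul_add, mul_div_cancel₀ _ hn0.ne'] at hσ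
    have hexp : Real.exp (n * τ k + Real.log x) = t k * x := by
      rw [Real.exp_add, Real.exp_log hx0]
    calc _ ≤ 4 * (d : ℝ) ^ 2 * ((n : ℝ) + 1) ^ m *
        ∑ g : Fin n → J with n * τ k + Real.log x ≤ Real.log (2 * d) +
          ∑ j, Real.log (q k.castSucc (g j) / q (Fin.last d) (g j)), kpow (q k.castSucc) n g := by
          refine mul_le_mul ?_ ?_ (Finset.sum_nonneg fun g _ => hq0 _ g) (by positivity)
          · nlinarith [sq_nonneg (d : ℝ)]
          · rw [Finset.sum_filter, Finset.sum_filter]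
            refine Finset.sum_le_sum fun g _ => ?_
            by_cases hg : kpow (q k.castSucc) n g = 0
            · simp [hg]
            split_ifs with ha hb
            · exact le_rfl
            · refine absurd ?_ hb
              rw [← Real.exp_le_exp, hexp, Real.exp_add, Real.exp_log (by positivity)]
              have e := kpow_eq_exp_mul (hq k.castSucc).1 (hq (Fin.last d)).1 (hqdom k) hg
              have h0 := hqd k g hg
              rw [e, mul_comm (Real.exp _), mul_div_mul_left _ _ h0, mul_div_assoc',
                le_div_iff₀ (ht0 k), mul_comm x] at ha
              exact ha
            · exact hq0 _ _
            · exact le_rfl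
    _ ≤ _ := hσ
    _ ≤ _ := by
          rw [Finset.sum_filter, Finset.sum_filter]
          refine Finset.sum_le_sum fun f _ => ?_
          by_cases hf : kpow (p k.castSucc) n f = 0
          · simp [hf]
          split_ifs with ha hb
          · exact le_rfl
          · refine absurd ⟨fun l hl => by rw [ha.1 ⟨l, hl⟩, zero_div], ?_⟩ hb
            have h4 := Real.exp_le_exp.2 ha.2
            have h0 := lt_of_le_of_ne (hp0 _ f) (hpd k f hf).symm
            rw [hexp] at h4
            rw [kpow_eq_exp_mul (hp k.castSucc).1 (hp (Fin.last d)).1 (hpdom k) hf,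
              le_div_iff₀ (mul_pos h0 (ht0 k))]
            nlinarith
          · exact hp0 _ _
          · exact le_rfl
  · intro f₀ hz hlt
    obtain ⟨k₀, hk₀⟩ := Function.ne_iff.1 hz
    have hk₀' : kpow (p k₀.castSucc) n f₀ ≠ 0 := fun h => hk₀ (by simp [h])
    have hl₀ := hpd k₀ f₀ hk₀'
    have hl₀' := lt_of_le_of_ne (hp0 _ f₀) hl₀.symm
    obtain ⟨c, hc0, hcq, hck, hcs⟩ := hB f₀ hl₀ ⟨k₀, hk₀'⟩ fun k hk => by
      have := hlt k fun l hl => by simp only [hk l hl, zero_div]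
      rw [div_lt_one (mul_pos hl₀' (ht0 k)), mul_comm] at this
      exact this.le
    refine ⟨c, hc0, hcq, fun g k => ?_, ?_⟩
    · have h5 := hck g k
      by_cases hg : kpow (q (Fin.last d)) n g = 0
      · have : c g = 0 := le_antisymm ((hcq g).trans_eq hg) (hc0 g)
        simp [hg, this]
      · have := (ht0 k).ne'
        have e1 : kpow (q (Fin.last d)) n g * (kpow (q k.castSucc) n g /
            (kpow (q (Fin.last d)) n g * t k)) = kpow (q k.castSucc) n g / t k := by field_simp
        rw [e1, mul_div_assoc', div_le_div_iff₀ (mul_pos hl₀' (ht0 k)) (ht0 k), ← mul_assoc]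
        exact mul_le_mul_of_nonneg_right h5 (ht0 k).le
    · refine le_trans (mul_le_mul hM2 ?_ (Finset.sum_nonneg fun f _ => hp0 _ f) (by positivity)) hcs
      rw [Finset.sum_filter, Finset.sum_filter]
      refine Finset.sum_le_sum fun f _ => ?_
      by_cases hf : kpow (p (Fin.last d)) n f = 0
      · simp [hf]
      split_ifs with ha hb
      · exact le_rfl
      · refine absurd ⟨hf, fun k => ?_⟩ hb
        have := congrFun ha k
        rw [div_eq_div_iff (mul_ne_zero hf (ht0 k).ne') (mul_ne_zero hl₀ (ht0 k).ne')] at this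
        exact mul_right_cancel₀ (ht0 k).ne' (by linear_combination this)
      · exact hp0 _ _
      · exact le_rfl

end LargeSample

section Majorization

variable {ι A B C A' B' : Type} [Fintype A] [Fintype B] [Fintype C] [Fintype A'] [Fintype B']

/-- Some stochastic matrix maps the columns of `p` to those of `q`. -/
def Majorizes (p : ι → A → ℝ) (q : ι → B → ℝ) : Prop :=
  ∃ T : B → A → ℝ, IsStoch T ∧ ∀ k y, ∑ x, T y x * p k x = q k y

lemma Majorizes.of_equiv {p : ι → A → ℝ} {q : ι → B → ℝ} (e : A ≃ B)
    (h : ∀ k x, q k (e x) = p k x) : Majorizes p q := by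
  refine ⟨fun y x => if e x = y then 1 else 0,
    ⟨fun y x => by positivity, fun x => by simp⟩, fun k y => ?_⟩
  rw [Finset.sum_eq_single (e.symm y)]
  · simp [← h]
  · intro x _ hx
    have : e x ≠ y := fun hxy => hx (by rw [← hxy, e.symm_apply_apply])
    simp [this]
  · simp

lemma Majorizes.trans {p : ι → A → ℝ} {q : ι → B → ℝ} {r : ι → C → ℝ}
    (h : Majorizes p q) (h' : Majorizes q r) : Majorizes p r := by
  obtain ⟨T, ⟨hT0, hT1⟩, hT⟩ := h
  obtain ⟨S, ⟨hS0, hS1⟩, hS⟩ := h'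
  refine ⟨fun z x => ∑ y, S z y * T y x, ⟨fun z x => Finset.sum_nonneg fun y _ =>
    mul_nonneg (hS0 z y) (hT0 y x), fun x => ?_⟩, fun k z => ?_⟩
  · rw [Finset.sum_comm]
    simp [← Finset.sum_mul, hS1, hT1]
  · simp only [Finset.sum_mul, ← hS, ← hT, Finset.mul_sum]
    rw [Finset.sum_comm]
    simp only [mul_assoc]

lemma Majorizes.sumElim {p : ι → A → ℝ} {q : ι → B → ℝ} (r : ι → C → ℝ) (h : Majorizes p q) :
    Majorizes (fun k => Sum.elim (r k) (p k)) (fun k => Sum.elim (r k) (q k)) := by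
  obtain ⟨T, ⟨hT0, hT1⟩, hT⟩ := h
  refine ⟨fun y x => Sum.elim (fun c => Sum.elim (fun c' => if c = c' then 1 else 0) 0 x)
    (fun b => Sum.elim 0 (T b) x) y, ⟨?_, ?_⟩, ?_⟩
  · rintro (c | b) (c' | a)
    · simp only [Sum.elim_inl]; split_ifs <;> norm_num
    · simp
    · simp
    · simpa using hT0 b a
  · rintro (c | a) <;> simp [hT1]
  · rintro k (c | b) <;> simp [hT]

lemma Majorizes.const_mul {p : ι → A → ℝ} {q : ι → B → ℝ} (c : ℝ) (h : Majorizes p q) :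
    Majorizes (fun k x => c * p k x) (fun k y => c * q k y) := by
  obtain ⟨T, hT, h⟩ := h
  refine ⟨T, hT, fun k y => ?_⟩
  simp only [← h, Finset.mul_sum]
  exact Finset.sum_congr rfl fun x _ => by ring

end Majorization

section Catalyst

variable {I J : Type} {n : ℕ}

/-- Words with a nonempty prefix over `J` and a nonempty suffix over `I`, of total length
`n + 1`. -/
abbrev MixedWord (I J : Type) (n : ℕ) : Type :=
  (ℓ : Fin n) × ((Fin (ℓ + 1) → J) × (Fin (n - ℓ) → I))

/-- Split the last `I`-letter off a word with an `I`-letter. -/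
def splitRight : MixedWord I J n ⊕ (Fin (n + 1) → I) → CatIdx I J n × I
  | .inl ⟨ℓ, f, g⟩ => (⟨ℓ.succ, f, fun j =>
      g ⟨j, by have := j.2; simp only [Fin.val_succ] at this; omega⟩⟩,
      g ⟨n - (ℓ + 1), by omega⟩)
  | .inr h => (⟨0, fun j => j.elim0, fun j =>
      h ⟨j, by have := j.2; simp only [Fin.val_zero] at this; omega⟩⟩,
      h (Fin.last n))

/-- Split the last `J`-letter off a word with a `J`-letter. -/
def splitLeft : MixedWord I J n ⊕ (Fin (n + 1) → J) → CatIdx I J n × J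
  | .inl ⟨ℓ, f, g⟩ => (⟨ℓ.castSucc, Fin.init f, g⟩, f (Fin.last _))
  | .inr h => (⟨Fin.last n, Fin.init h, fun j => absurd j.2 (by simp)⟩, h (Fin.last n))

lemma splitRight_bijective : Function.Bijective (splitRight (I := I) (J := J) (n := n)) := by
  constructor
  · rintro (⟨ℓ, f, g⟩ | h) (⟨ℓ', f', g'⟩ | h') e
    · simp only [splitRight, Prod.mk.injEq, Sigma.mk.injEq, Fin.succ_inj] at e
      obtain ⟨⟨rfl, e⟩, e'⟩ := e
      simp only [heq_eq_eq, Prod.mk.injEq] at e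
      obtain ⟨rfl, e⟩ := e
      congr
      funext j
      by_cases hj : (j : ℕ) < n - (ℓ + 1)
      · exact congrFun e ⟨j, hj⟩
      · have : j = ⟨n - (ℓ + 1), by omega⟩ := Fin.ext (by simp; omega)
        rw [this, e']
    · simp only [splitRight, Prod.mk.injEq, Sigma.mk.injEq] at e
      exact absurd e.1.1 (Fin.succ_ne_zero _)
    · simp only [splitRight, Prod.mk.injEq, Sigma.mk.injEq] at e
      exact absurd e.1.1.symm (Fin.succ_ne_zero _)
    · simp only [splitRight, Prod.mk.injEq, Sigma.mk.injEq, heq_eq_eq, true_and] at e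
      congr
      funext j
      by_cases hj : (j : ℕ) < n
      · exact congrFun e.1 ⟨j, hj⟩
      · have : j = Fin.last n := Fin.ext (by simp; omega)
        rw [this, e.2]
  · rintro ⟨⟨ℓ, f, g⟩, i⟩
    induction ℓ using Fin.cases with
    | zero =>
      refine ⟨.inr fun j => if h : (j : ℕ) < n then g ⟨j, h⟩ else i, ?_⟩
      simp only [splitRight, Prod.mk.injEq, Sigma.mk.injEq, heq_eq_eq, true_and]
      refine ⟨⟨funext fun j => j.elim0, funext fun j => ?_⟩, by simp⟩
      exact dif_pos j.2
    | succ ℓ =>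
      refine ⟨.inl ⟨ℓ, f, fun j => if h : (j : ℕ) < n - (ℓ + 1) then g ⟨j, h⟩ else i⟩, ?_⟩
      simp only [splitRight, Prod.mk.injEq, Sigma.mk.injEq, heq_eq_eq, true_and]
      refine ⟨funext fun j => dif_pos j.2, dif_neg (by omega)⟩

lemma splitLeft_bijective : Function.Bijective (splitLeft (I := I) (J := J) (n := n)) := by
  constructor
  · rintro (⟨ℓ, f, g⟩ | h) (⟨ℓ', f', g'⟩ | h') e
    · simp only [splitLeft, Prod.mk.injEq, Sigma.mk.injEq, Fin.castSucc_inj] at e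
      obtain ⟨⟨rfl, e⟩, e'⟩ := e
      simp only [heq_eq_eq, Prod.mk.injEq] at e
      obtain ⟨e, rfl⟩ := e
      congr
      rw [← Fin.snoc_init_self f, ← Fin.snoc_init_self f', e, e']
    · simp only [splitLeft, Prod.mk.injEq, Sigma.mk.injEq] at e
      exact absurd e.1.1 (Fin.castSucc_ne_last _)
    · simp only [splitLeft, Prod.mk.injEq, Sigma.mk.injEq] at e
      exact absurd e.1.1.symm (Fin.castSucc_ne_last _)
    · simp only [splitLeft, Prod.mk.injEq, Sigma.mk.injEq, heq_eq_eq, true_and, and_true] at e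
      congr
      rw [← Fin.snoc_init_self h, ← Fin.snoc_init_self h', e.1, e.2]
  · rintro ⟨⟨ℓ, f, g⟩, i⟩
    induction ℓ using Fin.lastCases with
    | last =>
      refine ⟨.inr (Fin.snoc f i), ?_⟩
      simp only [splitLeft, Prod.mk.injEq, Sigma.mk.injEq, heq_eq_eq, true_and]
      exact ⟨⟨Fin.init_snoc _ _, funext fun j => absurd j.2 (by simp)⟩, Fin.snoc_last _ _⟩
    | cast ℓ =>
      refine ⟨.inl ⟨ℓ, Fin.snoc f i, g⟩, ?_⟩
      simp only [splitLeft, Prod.mk.injEq, Sigma.mk.injEq, heq_eq_eq, true_and]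
      exact ⟨⟨Fin.init_snoc _ _, trivial⟩, Fin.snoc_last _ _⟩

lemma prod_fin_eq_mul_last {m m' : ℕ} (h : m = m' + 1) (a : Fin m → ℝ) :
    ∏ j, a j = (∏ j : Fin m', a ⟨j, by omega⟩) * a ⟨m', by omega⟩ := by
  subst h
  exact Fin.prod_univ_castSucc a

lemma kron_catVec_splitRight (p : I → ℝ) (q : J → ℝ) (x : MixedWord I J n ⊕ (Fin (n + 1) → I)) :
    kron (catVec n p q) p (splitRight x) = 1 / ((n : ℝ) + 1) *
      Sum.elim (fun x : MixedWord I J n => (∏ j, q (x.2.1 j)) * ∏ j, p (x.2.2 j))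
        (kpow p (n + 1)) x := by
  rcases x with ⟨ℓ, f, g⟩ | h
  · simp only [splitRight, kron, catVec, Sum.elim_inl, mul_assoc]
    rw [prod_fin_eq_mul_last (m' := n - (ℓ + 1)) (by omega) fun j => p (g j)]
    rfl
  · simp only [splitRight, kron, catVec, Sum.elim_inr, mul_assoc, kpow, Fin.prod_univ_castSucc]
    refine congrArg _ ((congrArg (· * _) (Fin.prod_univ_zero _)).trans ?_)
    rw [one_mul]
    rfl

lemma kron_catVec_splitLeft (p : I → ℝ) (q : J → ℝ) (x : MixedWord I J n ⊕ (Fin (n + 1) → J)) :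
    kron (catVec n p q) q (splitLeft x) = 1 / ((n : ℝ) + 1) *
      Sum.elim (fun x : MixedWord I J n => (∏ j, q (x.2.1 j)) * ∏ j, p (x.2.2 j))
        (kpow q (n + 1)) x := by
  rcases x with ⟨ℓ, f, g⟩ | h
  · simp only [splitLeft, kron, catVec, Sum.elim_inl, mul_assoc, Fin.prod_univ_castSucc, Fin.init]
    exact congrArg _ (congrArg _ (mul_comm _ _))
  · simp only [splitLeft, kron, catVec, Sum.elim_inr, mul_assoc, kpow, Fin.prod_univ_castSucc,
      Fin.init]
    refine congrArg _ (congrArg _ ((congrArg (· * _) (Fintype.prod_eq_one _ fun j =>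
      absurd j.2 (by simp))).trans (one_mul _)))

/-- Large-sample majorization yields catalytic majorization. -/
lemma Majorizes.kron_catVec [Fintype I] [Fintype J] {ι : Type} {p : ι → I → ℝ} {q : ι → J → ℝ}
    (h : Majorizes (fun k => kpow (p k) (n + 1)) (fun k => kpow (q k) (n + 1))) :
    Majorizes (fun k => kron (catVec n (p k) (q k)) (p k))
      (fun k => kron (catVec n (p k) (q k)) (q k)) := by
  have h1 := (h.sumElim fun k (x : MixedWord I J n) =>
    (∏ j, q k (x.2.1 j)) * ∏ j, p k (x.2.2 j)).const_mul (1 / ((n : ℝ) + 1))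
  refine (Majorizes.of_equiv (Equiv.ofBijective _ splitRight_bijective).symm fun k x => ?_).trans
    (h1.trans (Majorizes.of_equiv (Equiv.ofBijective _ splitLeft_bijective) fun k x => ?_))
  · obtain ⟨x, rfl⟩ := splitRight_bijective.2 x
    rw [kron_catVec_splitRight]
    congr 1
    exact congrArg _ (Equiv.ofBijective_symm_apply_apply _ splitRight_bijective x)
  · exact kron_catVec_splitLeft _ _ _

lemma catVec_ne_zero_iff {p : I → ℝ} {q : J → ℝ} {x : CatIdx I J n} :
    catVec n p q x ≠ 0 ↔ (∀ j, q (x.2.1 j) ≠ 0) ∧ ∀ j, p (x.2.2 j) ≠ 0 := by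
  have : ((n : ℝ) + 1) ≠ 0 := by positivity
  simp [catVec, Finset.prod_eq_zero_iff, this]

lemma IsProb.catVec [Fintype I] [Fintype J] {p : I → ℝ} {q : J → ℝ} (hp : IsProb p)
    (hq : IsProb q) (n : ℕ) : IsProb (catVec n p q) := by
  refine ⟨fun x => mul_nonneg (by positivity) (mul_nonneg (Finset.prod_nonneg fun j _ => hq.1 _)
    (Finset.prod_nonneg fun j _ => hp.1 _)), ?_⟩
  have h : ∀ ℓ : Fin (n + 1), ∑ x : (Fin (ℓ : ℕ) → J) × (Fin (n - (ℓ : ℕ)) → I),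
      (∏ j, q (x.1 j)) * ∏ j, p (x.2 j) = 1 := fun ℓ => by
    rw [Fintype.sum_prod_type]
    have h1 := hp.sum_kpow (n - ℓ)
    have h2 := hq.sum_kpow ℓ
    unfold _root_.kpow at h1 h2
    simp only [← Finset.mul_sum, h1, mul_one, h2]
  have h0 : (n : ℝ) + 1 ≠ 0 := by positivity
  unfold _root_.catVec
  rw [← Finset.mul_sum, Fintype.sum_sigma]
  simp [h, h0]

end Catalyst

section DataProcessing

variable {A B : Type} [Fintype A] [Fintype B] {d : ℕ}

lemma sum_mul_prod_rpow_le {ι : Type} [Fintype ι] {t : A → ℝ} (ht : ∀ x, 0 ≤ t x)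
    {p : ι → A → ℝ} (hp : ∀ k x, 0 ≤ p k x) {α : ι → ℝ} (hα : ∀ k, 0 ≤ α k)
    (hα1 : ∑ k, α k = 1) (hpos : ∀ k, α k ≠ 0 → 0 < ∑ x, t x * p k x) :
    ∑ x, t x * ∏ k, p k x ^ α k ≤ ∏ k, (∑ x, t x * p k x) ^ α k := by
  set s : ι → ℝ := fun k => ∑ x, t x * p k x with hs
  have hs0 : ∀ k, 0 ≤ s k := fun k => Finset.sum_nonneg fun x _ => mul_nonneg (ht x) (hp k x)
  have hprod : ∀ x, t x * ∏ k, p k x ^ α k =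
      (∏ k, s k ^ α k) * ∏ k, (t x * p k x / s k) ^ α k := fun x => by
    rw [← Finset.prod_mul_distrib]
    conv_lhs => rw [← Real.rpow_one (t x), ← hα1, Real.rpow_sum_of_nonneg (ht x) fun k _ => hα k]
    rw [← Finset.prod_mul_distrib]
    refine Finset.prod_congr rfl fun k _ => ?_
    by_cases hk : α k = 0
    · simp [hk]
    rw [← Real.mul_rpow (ht x) (hp k x), ← Real.mul_rpow (hs0 k)
      (div_nonneg (mul_nonneg (ht x) (hp k x)) (hs0 k)), mul_div_cancel₀ _ (hpos k hk).ne']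
  have hle : ∑ x, ∏ k, (t x * p k x / s k) ^ α k ≤ 1 := by
    calc ∑ x, ∏ k, (t x * p k x / s k) ^ α k ≤ ∑ x, ∑ k, α k * (t x * p k x / s k) :=
          Finset.sum_le_sum fun x _ => Real.geom_mean_le_arith_mean_weighted _ _ _
            (fun k _ => hα k) hα1 fun k _ => div_nonneg (mul_nonneg (ht x) (hp k x)) (hs0 k)
      _ = ∑ k, α k * (s k / s k) := by
          rw [Finset.sum_comm]
          simp only [← Finset.mul_sum, ← Finset.sum_div, hs]
      _ ≤ ∑ k, α k := Finset.sum_le_sum fun k _ => mul_le_of_le_one_right (hα k) (div_self_le_one _)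
      _ = 1 := hα1
  simp only [hprod, ← Finset.mul_sum]
  exact mul_le_of_le_one_right (Finset.prod_nonneg fun k _ => Real.rpow_nonneg (hs0 k) _) hle

lemma Majorizes.phiAC_le {p : Fin d → A → ℝ} {q : Fin d → B → ℝ} (h : Majorizes p q)
    (hp : ∀ k x, 0 ≤ p k x) {α : Fin d → ℝ} {C : Finset (Fin d)} (hα : ∀ k, 0 ≤ α k)
    (hα1 : ∑ k, α k = 1) (hαC : ∀ k, 0 < α k → k ∈ C) : phiAC d α C p ≤ phiAC d α C q := by
  obtain ⟨T, ⟨hT0, hT1⟩, hT⟩ := h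
  have hq : ∀ k y, 0 ≤ q k y := fun k y => by
    rw [← hT]; exact Finset.sum_nonneg fun x _ => mul_nonneg (hT0 y x) (hp k x)
  have hsupp : ∀ {x y k}, T y x ≠ 0 → p k x ≠ 0 → q k y ≠ 0 := fun {x y k} h1 h2 => by
    rw [← hT]
    exact (Finset.sum_pos' (fun x _ => mul_nonneg (hT0 y x) (hp k x)) ⟨x, Finset.mem_univ x,
      lt_of_le_of_ne (mul_nonneg (hT0 y x) (hp k x)) (mul_ne_zero h1 h2).symm⟩).ne'
  calc phiAC d α C p = ∑ y, ∑ x with ∀ c ∈ C, p c x ≠ 0, T y x * ∏ k, p k x ^ α k := by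
        rw [Finset.sum_comm]
        simp only [← Finset.sum_mul, hT1, one_mul]
        rfl
    _ ≤ ∑ y, if ∀ c ∈ C, q c y ≠ 0 then ∏ k, q k y ^ α k else 0 := by
        refine Finset.sum_le_sum fun y _ => ?_
        split_ifs with hy
        · simp only [← hT] at hy ⊢
          refine (Finset.sum_le_sum_of_subset_of_nonneg (Finset.filter_subset _ _) fun x _ _ =>
            mul_nonneg (hT0 y x) (Finset.prod_nonneg fun k _ => Real.rpow_nonneg (hp k x) _)).trans
            (sum_mul_prod_rpow_le (hT0 y) hp hα hα1 fun k hk => ?_)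
          exact lt_of_le_of_ne (by rw [hT]; exact hq k y)
            (hy k (hαC k (lt_of_le_of_ne (hα k) (Ne.symm hk)))).symm
        · refine (Finset.sum_eq_zero fun x hx => ?_).le
          have : T y x = 0 := by
            by_contra h1
            exact hy fun c hc => hsupp h1 ((Finset.mem_filter.1 hx).2 c hc)
          rw [this, zero_mul]
    _ = phiAC d α C q := by rw [phiAC, Finset.sum_filter]

/-- Data processing for `f`-divergences. -/
lemma sum_mul_map_div_le {T : B → A → ℝ} (hT : IsStoch T) {p r : A → ℝ} (hp : ∀ x, 0 ≤ p x)
    (hr : ∀ x, 0 ≤ r x) (hpr : ∀ x, p x ≠ 0 → r x ≠ 0) {φ : ℝ → ℝ}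
    (hφ : ConvexOn ℝ (Set.Ici 0) φ) :
    ∑ y, (∑ x, T y x * r x) * φ ((∑ x, T y x * p x) / ∑ x, T y x * r x) ≤
      ∑ x, r x * φ (p x / r x) := by
  obtain ⟨hT0, hT1⟩ := hT
  calc _ ≤ ∑ y, ∑ x, T y x * (r x * φ (p x / r x)) := by
        refine Finset.sum_le_sum fun y _ => ?_
        have h0 : ∀ x ∈ Finset.univ, 0 ≤ T y x * r x := fun x _ => mul_nonneg (hT0 y x) (hr x)
        rcases (Finset.sum_nonneg h0).eq_or_lt' with hs | hs
        · rw [hs, zero_mul]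
          refine (Finset.sum_eq_zero fun x hx => ?_).ge
          rw [← mul_assoc, (Finset.sum_eq_zero_iff_of_nonneg h0).1 hs x hx, zero_mul]
        · set s := ∑ x, T y x * r x
          have h1 := hφ.map_sum_le (t := Finset.univ) (w := fun x => T y x * r x / s)
            (p := fun x => p x / r x) (fun x hx => div_nonneg (h0 x hx) hs.le)
            (by rw [← Finset.sum_div, div_self hs.ne'])
            fun x _ => Set.mem_Ici.2 (div_nonneg (hp x) (hr x))
          simp only [smul_eq_mul] at h1
          have e : ∑ x, T y x * r x / s * (p x / r x) = (∑ x, T y x * p x) / s := by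
            rw [Finset.sum_div]
            refine Finset.sum_congr rfl fun x _ => ?_
            by_cases hx : r x = 0
            · have : p x = 0 := by
                by_contra h
                exact hpr x h hx
              simp [this]
            · field_simp
          rw [e] at h1
          refine (mul_le_mul_of_nonneg_left h1 hs.le).trans_eq ?_
          rw [Finset.mul_sum]
          refine Finset.sum_congr rfl fun x _ => ?_
          field_simp
    _ = _ := by
        rw [Finset.sum_comm]
        simp only [← Finset.sum_mul, hT1, one_mul]

lemma phiDC_eq_sum {p : Fin (d + 1) → A → ℝ} (hp : ∀ k x, 0 ≤ p k x) (α : ℝ) (k : Fin d) :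
    phiDC d α k p = ∑ x, p (Fin.last d) x * (p k.castSucc x / p (Fin.last d) x) ^ α := by
  rw [phiDC, Finset.sum_filter]
  refine Finset.sum_congr rfl fun x _ => ?_
  by_cases hx : p (Fin.last d) x = 0
  · simp [hx]
  · rw [if_pos hx, Real.div_rpow (hp _ x) (hp _ x),
      Real.rpow_sub (lt_of_le_of_ne (hp _ x) (Ne.symm hx)), Real.rpow_one]
    ring

lemma D1_eq_sum_mul {p r : A → ℝ} (hpr : ∀ x, p x ≠ 0 → r x ≠ 0) :
    D1 p r = ∑ x, r x * (p x / r x * Real.log (p x / r x)) := by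
  rw [D1_eq_sum]
  refine Finset.sum_congr rfl fun x _ => ?_
  by_cases hx : p x = 0
  · simp [hx]
  · rw [← mul_assoc, mul_div_cancel₀ _ (hpr x hx)]

lemma Majorizes.phiDC_le {p : Fin (d + 1) → A → ℝ} {q : Fin (d + 1) → B → ℝ} (h : Majorizes p q)
    (hp : ∀ k x, 0 ≤ p k x) (hq : ∀ k x, 0 ≤ q k x) {k : Fin d}
    (hpd : ∀ x, p k.castSucc x ≠ 0 → p (Fin.last d) x ≠ 0) {α : ℝ} (hα : 1 ≤ α) :
    phiDC d α k q ≤ phiDC d α k p := by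
  obtain ⟨T, hT, h⟩ := h
  rw [phiDC_eq_sum hp, phiDC_eq_sum hq]
  simp only [← h]
  exact sum_mul_map_div_le hT (hp _) (hp _) hpd (convexOn_rpow hα)

lemma Majorizes.D1_le {p : Fin (d + 1) → A → ℝ} {q : Fin (d + 1) → B → ℝ} (h : Majorizes p q)
    (hp : ∀ k x, 0 ≤ p k x) {k : Fin d}
    (hpd : ∀ x, p k.castSucc x ≠ 0 → p (Fin.last d) x ≠ 0)
    (hqd : ∀ x, q k.castSucc x ≠ 0 → q (Fin.last d) x ≠ 0) :
    D1 (q k.castSucc) (q (Fin.last d)) ≤ D1 (p k.castSucc) (p (Fin.last d)) := by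
  obtain ⟨T, hT, h⟩ := h
  rw [D1_eq_sum_mul hpd, D1_eq_sum_mul hqd]
  simp only [← h]
  exact sum_mul_map_div_le hT (hp _) (hp _) hpd Real.convexOn_mul_log

lemma Majorizes.Dinf_le {p : Fin (d + 1) → A → ℝ} {q : Fin (d + 1) → B → ℝ} (h : Majorizes p q)
    (hp : ∀ k, IsProb (p k)) (hq : ∀ k, IsProb (q k)) {k : Fin d}
    (hpd : ∀ x, p k.castSucc x ≠ 0 → p (Fin.last d) x ≠ 0)
    (hqd : ∀ x, q k.castSucc x ≠ 0 → q (Fin.last d) x ≠ 0) :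
    Dinf (q k.castSucc) (q (Fin.last d)) ≤ Dinf (p k.castSucc) (p (Fin.last d)) := by
  obtain ⟨T, hT, h⟩ := h
  obtain ⟨hle, -⟩ := Dinf_spec (hp k.castSucc) (hp (Fin.last d)).1 hpd
  obtain ⟨-, y, hy, he⟩ := Dinf_spec (hq k.castSucc) (hq (Fin.last d)).1 hqd
  have hx : ∀ x, p k.castSucc x ≤
      Real.exp (Dinf (p k.castSucc) (p (Fin.last d))) * p (Fin.last d) x := fun x => by
    by_cases hx : p k.castSucc x = 0
    · rw [hx]; exact mul_nonneg (Real.exp_pos _).le ((hp _).1 x)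
    · have h1 := lt_of_le_of_ne ((hp _).1 x) (Ne.symm hx)
      have h2 := lt_of_le_of_ne ((hp _).1 x) (hpd x hx).symm
      rw [← div_le_iff₀ h2, ← Real.log_le_iff_le_exp (div_pos h1 h2)]
      exact hle x hx
  have h1 := lt_of_le_of_ne ((hq _).1 y) (Ne.symm hy)
  have h2 := lt_of_le_of_ne ((hq _).1 y) (hqd y hy).symm
  rw [← he, Real.log_le_iff_le_exp (div_pos h1 h2), div_le_iff₀ h2, ← h, ← h, Finset.mul_sum]
  refine Finset.sum_le_sum fun x _ => ?_
  rw [mul_left_comm]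
  exact mul_le_mul_of_nonneg_left (hx x) (hT.1 y x)

end DataProcessing

lemma kron_ne_zero_iff {A B : Type} {r : A → ℝ} {p : B → ℝ} {x : A × B} :
    kron r p x ≠ 0 ↔ r x.1 ≠ 0 ∧ p x.2 ≠ 0 := mul_ne_zero_iff

lemma log_kron_div {A B : Type} {r r' : A → ℝ} {p p' : B → ℝ} (hr' : ∀ x, r x ≠ 0 → r' x ≠ 0)
    (hp' : ∀ x, p x ≠ 0 → p' x ≠ 0) {x : A × B} (hx : kron r p x ≠ 0) :
    Real.log (kron r p x / kron r' p' x) =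
      Real.log (r x.1 / r' x.1) + Real.log (p x.2 / p' x.2) := by
  obtain ⟨h1, h2⟩ := kron_ne_zero_iff.1 hx
  rw [kron, kron, mul_div_mul_comm,
    Real.log_mul (div_ne_zero h1 (hr' _ h1)) (div_ne_zero h2 (hp' _ h2))]

section Kronecker

variable {A B : Type} [Fintype A] [Fintype B] {d : ℕ}

lemma IsProb.kron {r : A → ℝ} {p : B → ℝ} (hr : IsProb r) (hp : IsProb p) : IsProb (kron r p) := by
  refine ⟨fun x => mul_nonneg (hr.1 _) (hp.1 _), ?_⟩
  simp only [_root_.kron, Fintype.sum_prod_type, ← Finset.mul_sum, hp.2, hr.2, mul_one]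

lemma phiAC_kron {r : Fin d → A → ℝ} {p : Fin d → B → ℝ} (hr : ∀ k x, 0 ≤ r k x)
    (hp : ∀ k x, 0 ≤ p k x) (α : Fin d → ℝ) (C : Finset (Fin d)) :
    phiAC d α C (fun k => kron (r k) (p k)) = phiAC d α C r * phiAC d α C p := by
  simp only [phiAC, Finset.sum_filter, Fintype.sum_prod_type, Finset.sum_mul_sum]
  refine Finset.sum_congr rfl fun x _ => Finset.sum_congr rfl fun y _ => ?_
  simp only [kron, Real.mul_rpow (hr _ _) (hp _ _), Finset.prod_mul_distrib, mul_ne_zero_iff]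
  by_cases h1 : ∀ c ∈ C, r c x ≠ 0
  · by_cases h2 : ∀ c ∈ C, p c y ≠ 0
    · rw [if_pos h1, if_pos h2, if_pos fun c hc => ⟨h1 c hc, h2 c hc⟩]
    · rw [if_neg h2, mul_zero, if_neg fun h => h2 fun c hc => (h c hc).2]
  · rw [if_neg h1, zero_mul, if_neg fun h => h1 fun c hc => (h c hc).1]

lemma phiAC_pos {r : Fin d → A → ℝ} (hr : ∀ k x, 0 ≤ r k x) (hsup : ∃ z, ∀ k, r k z ≠ 0)
    (α : Fin d → ℝ) (C : Finset (Fin d)) : 0 < phiAC d α C r := by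
  obtain ⟨z, hz⟩ := hsup
  exact Finset.sum_pos' (fun x _ => Finset.prod_nonneg fun k _ => Real.rpow_nonneg (hr k x) _)
    ⟨z, by simp [hz], Finset.prod_pos fun k _ => Real.rpow_pos_of_pos
      (lt_of_le_of_ne (hr k z) (hz k).symm) _⟩

lemma phiDC_kron {r : Fin (d + 1) → A → ℝ} {p : Fin (d + 1) → B → ℝ} (hr : ∀ k x, 0 ≤ r k x)
    (hp : ∀ k x, 0 ≤ p k x) (α : ℝ) (k : Fin d) :
    phiDC d α k (fun k => kron (r k) (p k)) = phiDC d α k r * phiDC d α k p := by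
  simp only [phiDC, Finset.sum_filter, Fintype.sum_prod_type, Finset.sum_mul_sum]
  refine Finset.sum_congr rfl fun x _ => Finset.sum_congr rfl fun y _ => ?_
  simp only [kron, Real.mul_rpow (hr _ _) (hp _ _), mul_ne_zero_iff]
  by_cases h1 : r (Fin.last d) x = 0
  · simp [h1]
  · by_cases h2 : p (Fin.last d) y = 0
    · simp [h2]
    · simp only [h1, h2, not_false_eq_true, and_self, if_true, ne_eq]
      ring

lemma phiDC_pos {r : Fin (d + 1) → A → ℝ} (hr : ∀ k x, 0 ≤ r k x) (hsup : ∃ z, ∀ k, r k z ≠ 0)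
    (α : ℝ) (k : Fin d) : 0 < phiDC d α k r := by
  obtain ⟨z, hz⟩ := hsup
  have hpos : ∀ k, 0 < r k z := fun k => lt_of_le_of_ne (hr k z) (hz k).symm
  exact Finset.sum_pos' (fun x _ => mul_nonneg (Real.rpow_nonneg (hr _ x) _)
    (Real.rpow_nonneg (hr _ x) _))
    ⟨z, by simp [hz], mul_pos (Real.rpow_pos_of_pos (hpos _) _) (Real.rpow_pos_of_pos (hpos _) _)⟩

lemma D1_kron {r r' : A → ℝ} {p p' : B → ℝ} (hr : IsProb r) (hp : IsProb p)
    (hr' : ∀ x, r x ≠ 0 → r' x ≠ 0) (hp' : ∀ x, p x ≠ 0 → p' x ≠ 0) :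
    D1 (kron r p) (kron r' p') = D1 r r' + D1 p p' := by
  have e : ∀ x, kron r p x * Real.log (kron r p x / kron r' p' x) =
      r x.1 * Real.log (r x.1 / r' x.1) * p x.2 +
        r x.1 * (p x.2 * Real.log (p x.2 / p' x.2)) := fun x => by
    by_cases hx : kron r p x = 0
    · rcases mul_eq_zero.1 hx with h | h <;> simp [hx, h]
    · rw [log_kron_div hr' hp' hx, kron]; ring
  simp only [D1_eq_sum, e, Fintype.sum_prod_type, Finset.sum_add_distrib, ← Finset.mul_sum,
    ← Finset.sum_mul, hp.2, hr.2, one_mul, mul_one]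

lemma Dinf_kron {r r' : A → ℝ} {p p' : B → ℝ} (hr : IsProb r) (hp : IsProb p) (hr0 : IsProb r')
    (hp0 : IsProb p') (hr' : ∀ x, r x ≠ 0 → r' x ≠ 0) (hp' : ∀ x, p x ≠ 0 → p' x ≠ 0) :
    Dinf (kron r p) (kron r' p') = Dinf r r' + Dinf p p' := by
  obtain ⟨h1, x, hx, ex⟩ := Dinf_spec hr hr0.1 hr'
  obtain ⟨h2, y, hy, ey⟩ := Dinf_spec hp hp0.1 hp'
  obtain ⟨h3, z, hz, ez⟩ := Dinf_spec (hr.kron hp) (hr0.kron hp0).1 fun x hx =>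
    kron_ne_zero_iff.2 ⟨hr' _ (kron_ne_zero_iff.1 hx).1, hp' _ (kron_ne_zero_iff.1 hx).2⟩
  have hxy : kron r p (x, y) ≠ 0 := mul_ne_zero hx hy
  refine le_antisymm ?_ ?_
  · rw [← ez, log_kron_div hr' hp' hz]
    exact add_le_add (h1 _ (kron_ne_zero_iff.1 hz).1) (h2 _ (kron_ne_zero_iff.1 hz).2)
  · rw [← ex, ← ey, ← log_kron_div (x := (x, y)) hr' hp' hxy]
    exact h3 _ hxy

end Kronecker

/-- Catalytic majorization implies the non-strict inequalities for all monotones. -/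
theorem monotones_le_of_majorizes_kron {I J R : Type} [Fintype I] [Fintype J] [Fintype R] {d : ℕ}
    {p : Fin (d + 1) → I → ℝ} {q : Fin (d + 1) → J → ℝ} {r : Fin (d + 1) → R → ℝ}
    (hp : ∀ k, IsProb (p k)) (hq : ∀ k, IsProb (q k)) (hr : ∀ k, IsProb (r k))
    (hpdom : ∀ (k : Fin d) x, p k.castSucc x ≠ 0 → p (Fin.last d) x ≠ 0)
    (hqdom : ∀ (k : Fin d) y, q k.castSucc y ≠ 0 → q (Fin.last d) y ≠ 0)
    (hrdom : ∀ (k : Fin d) z, r k.castSucc z ≠ 0 → r (Fin.last d) z ≠ 0)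
    (hrsup : ∃ z, ∀ k, r k z ≠ 0)
    (h : Majorizes (fun k => kron (r k) (p k)) (fun k => kron (r k) (q k))) :
    (∀ (α : Fin (d + 1) → ℝ) (C : Finset (Fin (d + 1))),
      (∀ k, 0 ≤ α k) → (∑ k, α k = 1) → (∀ k, 0 < α k → k ∈ C) →
      phiAC (d + 1) α C p ≤ phiAC (d + 1) α C q) ∧
    (∀ (c : Fin d) (α : ℝ), 1 < α → phiDC d α c q ≤ phiDC d α c p) ∧
    ∀ k : Fin d,
      D1 (q k.castSucc) (q (Fin.last d)) ≤ D1 (p k.castSucc) (p (Fin.last d)) ∧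
      Dinf (q k.castSucc) (q (Fin.last d)) ≤ Dinf (p k.castSucc) (p (Fin.last d)) := by
  have hp0 := fun k => (hp k).1
  have hq0 := fun k => (hq k).1
  have hr0 := fun k => (hr k).1
  have hrp := fun k => (hr k).kron (hp k)
  have hrq := fun k => (hr k).kron (hq k)
  have hrpd : ∀ (k : Fin d) x, kron (r k.castSucc) (p k.castSucc) x ≠ 0 →
      kron (r (Fin.last d)) (p (Fin.last d)) x ≠ 0 := fun k x hx =>
    kron_ne_zero_iff.2 ⟨hrdom k _ (kron_ne_zero_iff.1 hx).1, hpdom k _ (kron_ne_zero_iff.1 hx).2⟩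
  have hrqd : ∀ (k : Fin d) x, kron (r k.castSucc) (q k.castSucc) x ≠ 0 →
      kron (r (Fin.last d)) (q (Fin.last d)) x ≠ 0 := fun k x hx =>
    kron_ne_zero_iff.2 ⟨hrdom k _ (kron_ne_zero_iff.1 hx).1, hqdom k _ (kron_ne_zero_iff.1 hx).2⟩
  refine ⟨fun α C hα hα1 hαC => ?_, fun k α hα => ?_, fun k => ⟨?_, ?_⟩⟩
  · have h1 := h.phiAC_le (fun k => (hrp k).1) hα hα1 hαC
    rw [phiAC_kron hr0 hp0, phiAC_kron hr0 hq0] at h1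
    exact le_of_mul_le_mul_left h1 (phiAC_pos hr0 hrsup α C)
  · have h1 := h.phiDC_le (fun k => (hrp k).1) (fun k => (hrq k).1) (hrpd k) hα.le
    rw [phiDC_kron hr0 hp0, phiDC_kron hr0 hq0] at h1
    exact le_of_mul_le_mul_left h1 (phiDC_pos hr0 hrsup α k)
  · have h1 := h.D1_le (fun k => (hrp k).1) (hrpd k) (hrqd k)
    rw [D1_kron (hr _) (hp _) (hrdom k) (hpdom k), D1_kron (hr _) (hq _) (hrdom k) (hqdom k)] at h1
    linarith
  · have h1 := h.Dinf_le hrp hrq (hrpd k) (hrqd k)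
    rw [Dinf_kron (hr _) (hp _) (hr _) (hp _) (hrdom k) (hpdom k),
      Dinf_kron (hr _) (hq _) (hr _) (hq _) (hrdom k) (hqdom k)] at h1
    linarith

/-- exact large-sample / catalytic majorization, one dominating
column.  Columns are indexed by `Fin (d+1)`, `d ≥ 1`, with the dominating column
`Fin.last d`.  Under the strict inequalities (1) for the `Φ_{α,C}` with `(α,C)` not
degenerate on `V^d_{d.c.}`, (2) for the `Φ_{α,c}` with `α > 1`, and (3) for `D₁` and
`D_∞`, exact catalytic majorization (with explicit binomial catalysts for large `n`)
and exact large-sample majorization hold; conversely either of these implies the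
non-strict inequalities. -/
theorem stmt15 {I J : Type} [Fintype I] [Fintype J] (d : ℕ) (hd : 1 ≤ d)
    (p : Fin (d + 1) → I → ℝ) (q : Fin (d + 1) → J → ℝ)
    (hp : ∀ k, IsProb (p k)) (hq : ∀ k, IsProb (q k))
    (hpsup : ∃ x, ∀ k, p k x ≠ 0) (hqsup : ∃ y, ∀ k, q k y ≠ 0)
    (hpdom : ∀ (k : Fin d) x, p k.castSucc x ≠ 0 → p (Fin.last d) x ≠ 0)
    (hqdom : ∀ (k : Fin d) y, q k.castSucc y ≠ 0 → q (Fin.last d) y ≠ 0) :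
    (((∀ (α : Fin (d + 1) → ℝ) (C : Finset (Fin (d + 1))),
        (∀ k, 0 ≤ α k) → (∑ k, α k = 1) → (∀ k, 0 < α k → k ∈ C) →
        ¬ (∃ k, α = stdBasis (d + 1) k ∧ C ⊆ {k, Fin.last d}) →
        phiAC (d + 1) α C p < phiAC (d + 1) α C q) ∧
      (∀ (c : Fin d) (α : ℝ), 1 < α → phiDC d α c q < phiDC d α c p) ∧
      (∀ k : Fin d,
        D1 (q k.castSucc) (q (Fin.last d)) < D1 (p k.castSucc) (p (Fin.last d)) ∧
        Dinf (q k.castSucc) (q (Fin.last d)) < Dinf (p k.castSucc) (p (Fin.last d)))) →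
      ((∃ (R : Type) (_ : Fintype R) (r : Fin (d + 1) → R → ℝ),
          (∀ k, IsProb (r k)) ∧ (∃ z, ∀ k, r k z ≠ 0) ∧
          (∀ (k : Fin d) z, r k.castSucc z ≠ 0 → r (Fin.last d) z ≠ 0) ∧
          ∃ T : R × J → R × I → ℝ, IsStoch T ∧
            ∀ k y, ∑ x, T y x * kron (r k) (p k) x = kron (r k) (q k) y) ∧
       (∃ N : ℕ, ∀ n ≥ N,
          ∃ T : CatIdx I J n × J → CatIdx I J n × I → ℝ, IsStoch T ∧
            ∀ k y, ∑ x, T y x * kron (catVec n (p k) (q k)) (p k) x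
              = kron (catVec n (p k) (q k)) (q k) y) ∧
       (∃ N : ℕ, ∀ n ≥ N,
          ∃ T : (Fin n → J) → (Fin n → I) → ℝ, IsStoch T ∧
            ∀ k g, ∑ f, T g f * kpow (p k) n f = kpow (q k) n g))) ∧
    (((∃ (R : Type) (_ : Fintype R) (r : Fin (d + 1) → R → ℝ),
          (∀ k, IsProb (r k)) ∧ (∃ z, ∀ k, r k z ≠ 0) ∧
          (∀ (k : Fin d) z, r k.castSucc z ≠ 0 → r (Fin.last d) z ≠ 0) ∧
          ∃ T : R × J → R × I → ℝ, IsStoch T ∧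
            ∀ k y, ∑ x, T y x * kron (r k) (p k) x = kron (r k) (q k) y) ∨
      (∃ n : ℕ, 1 ≤ n ∧
          ∃ T : (Fin n → J) → (Fin n → I) → ℝ, IsStoch T ∧
            ∀ k g, ∑ f, T g f * kpow (p k) n f = kpow (q k) n g)) →
      ((∀ (α : Fin (d + 1) → ℝ) (C : Finset (Fin (d + 1))),
        (∀ k, 0 ≤ α k) → (∑ k, α k = 1) → (∀ k, 0 < α k → k ∈ C) →
        ¬ (∃ k, α = stdBasis (d + 1) k ∧ C ⊆ {k, Fin.last d}) →
        phiAC (d + 1) α C p ≤ phiAC (d + 1) α C q) ∧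
      (∀ (c : Fin d) (α : ℝ), 1 < α → phiDC d α c q ≤ phiDC d α c p) ∧
      (∀ k : Fin d,
        D1 (q k.castSucc) (q (Fin.last d)) ≤ D1 (p k.castSucc) (p (Fin.last d)) ∧
        Dinf (q k.castSucc) (q (Fin.last d)) ≤ Dinf (p k.castSucc) (p (Fin.last d))))) := by
  have hdom : ∀ n (k : Fin d) z, catVec n (p k.castSucc) (q k.castSucc) z ≠ 0 →
      catVec n (p (Fin.last d)) (q (Fin.last d)) z ≠ 0 := fun n k z hz => by
    rw [catVec_ne_zero_iff] at hz ⊢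
    exact ⟨fun j => hqdom k _ (hz.1 j), fun j => hpdom k _ (hz.2 j)⟩
  have hsup : ∀ n, ∃ z, ∀ k, catVec n (p k) (q k) z ≠ 0 := fun n => by
    obtain ⟨x, hx⟩ := hpsup
    obtain ⟨y, hy⟩ := hqsup
    exact ⟨⟨0, fun _ => y, fun _ => x⟩, fun k =>
      catVec_ne_zero_iff.2 ⟨fun _ => hy k, fun _ => hx k⟩⟩
  refine ⟨fun ⟨h1, h2, h3⟩ => ?_, fun h => ?_⟩
  · obtain ⟨N, hN⟩ := Filter.eventually_atTop.1
      (eventually_exists_isStoch_kpow hd hp hq hpsup hqsup hpdom hqdom h1 h2 h3)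
    have hcat : ∀ n ≥ N, Majorizes (fun k => kron (catVec n (p k) (q k)) (p k))
        (fun k => kron (catVec n (p k) (q k)) (q k)) := fun n hn =>
      Majorizes.kron_catVec (hN (n + 1) (by omega))
    exact ⟨⟨CatIdx I J N, inferInstance, fun k => catVec N (p k) (q k),
      fun k => (hp k).catVec (hq k) N, hsup N, hdom N, hcat N le_rfl⟩, ⟨N, hcat⟩, ⟨N, hN⟩⟩
  · obtain ⟨R, _, r, hr, hrsup, hrdom, hT⟩ : ∃ (R : Type) (_ : Fintype R)
        (r : Fin (d + 1) → R → ℝ), (∀ k, IsProb (r k)) ∧ (∃ z, ∀ k, r k z ≠ 0) ∧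
        (∀ (k : Fin d) z, r k.castSucc z ≠ 0 → r (Fin.last d) z ≠ 0) ∧
        Majorizes (fun k => kron (r k) (p k)) (fun k => kron (r k) (q k)) := by
      rcases h with h | ⟨n, hn, hT⟩
      · exact h
      · obtain ⟨n, rfl⟩ : ∃ m, n = m + 1 := ⟨n - 1, by omega⟩
        exact ⟨CatIdx I J n, inferInstance, fun k => catVec n (p k) (q k),
          fun k => (hp k).catVec (hq k) n, hsup n, hdom n, Majorizes.kron_catVec hT⟩
    obtain ⟨h1, h2⟩ := monotones_le_of_majorizes_kron hp hq hr hpdom hqdom hrdom hrsup hT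
    exact ⟨fun α C hα hα1 hαC _ => h1 α C hα hα1 hαC, h2⟩
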